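/- Let t be an even integer, t ≥ 2, and let K be a finite group of order t³ with a Kantor family (F, F*) of type (t,t). Suppose there is a normal subgroup C of K of order t such that A* = A·C for every A ∈ F (the skew translation condition). Then K is an elementary abelian 2-group, i.e., K is abelian and every element has order dividing 2. -/

import Mathlib

open scoped Pointwise

/-- A Kantor family of type `(u, v)` in a finite group `K` of order `u² * v`. -/
structure KantorFamily (K : Type*) [Group K] [Fintype K] (u v : ℕ) : Type _ where
  F : Finset (Subgroup K)
  star : Subgroup K → Subgroup K
  two_le_u : 2 ≤ u
  two_le_v : 2 ≤ v
  card_K : Fintype.card K = u ^ 2 * v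
  card_F : F.card = v + 1
  star_injOn : ∀ A ∈ F, ∀ B ∈ F, star A = star B → A = B
  le_star : ∀ A ∈ F, A ≤ star A
  card_mem : ∀ A ∈ F, Nat.card A = u
  card_star : ∀ A ∈ F, Nat.card (star A) = u * v
  prod_inter : ∀ A ∈ F, ∀ B ∈ F, ∀ C ∈ F, A ≠ B → B ≠ C → A ≠ C →
    ∀ g : K, (∃ a ∈ A, ∃ b ∈ B, g = a * b) → g ∈ C → g = 1
  inter_star : ∀ A ∈ F, ∀ B ∈ F, A ≠ B → ∀ g : K, g ∈ A → g ∈ star B → g = 1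

open scoped commutatorElement

/-- Basic data. -/
structure ASConf {K : Type*} [Group K] [Fintype K] (t : ℕ) (F : Finset (Subgroup K))
    (C : Subgroup K) : Prop where
  two_le : 2 ≤ t
  even : Even t
  normal : C.Normal
  card_K : Nat.card K = t ^ 3
  card_F : F.card = t + 1
  card_A : ∀ A ∈ F, Nat.card A = t
  card_C : Nat.card C = t
  card_H : ∀ A ∈ F, Nat.card (A ⊔ C : Subgroup K) = t ^ 2
  mem_H : ∀ A ∈ F, ∀ x, x ∈ A ⊔ C ↔ ∃ a ∈ A, ∃ c ∈ C, x = a * c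
  prod : ∀ A ∈ F, ∀ B ∈ F, ∀ D ∈ F, A ≠ B → B ≠ D → A ≠ D →
    ∀ a ∈ A, ∀ b ∈ B, a * b ∈ D → a * b = 1
  inter : ∀ A ∈ F, ∀ B ∈ F, A ≠ B → ∀ g ∈ A, g ∈ B ⊔ C → g = 1

namespace ASConf
variable {K : Type*} [Group K] [Fintype K] {t : ℕ} {F : Finset (Subgroup K)} {C : Subgroup K}

theorem exists_ne (h : ASConf t F C) (A : Subgroup K) : ∃ B ∈ F, B ≠ A := by
  have h1 : 1 < F.card := by have := h.card_F; have := h.two_le; omega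
  exact Finset.exists_mem_ne h1 A

theorem exists_ne2 (h : ASConf t F C) (A B : Subgroup K) : ∃ D ∈ F, D ≠ A ∧ D ≠ B := by
  classical
  have h1 : ({A, B} : Finset (Subgroup K)).card < F.card := by
    have := h.card_F; have := h.two_le
    have := Finset.card_le_two (a := A) (b := B)
    omega
  obtain ⟨D, hD, hD2⟩ := Finset.exists_mem_notMem_of_card_lt_card h1
  simp at hD2
  exact ⟨D, hD, hD2⟩

theorem A_inter_C (h : ASConf t F C) {A : Subgroup K} (hA : A ∈ F) {g : K} (hg : g ∈ A)
    (hc : g ∈ C) : g = 1 := by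
  obtain ⟨B, hB, hne⟩ := h.exists_ne A
  exact h.inter A hA B hB hne.symm g hg (Subgroup.mem_sup_right hc)

theorem A_inter_A (h : ASConf t F C) {A B : Subgroup K} (hA : A ∈ F) (hB : B ∈ F) (hne : A ≠ B)
    {g : K} (hg : g ∈ A) (hc : g ∈ B) : g = 1 :=
  h.inter A hA B hB hne g hg (Subgroup.mem_sup_left hc)

theorem H_inter (h : ASConf t F C) {A B : Subgroup K} (hA : A ∈ F) (hB : B ∈ F) (hne : A ≠ B)
    {g : K} (hg : g ∈ A ⊔ C) (hg' : g ∈ B ⊔ C) : g ∈ C := by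
  obtain ⟨a, ha, c, hc, rfl⟩ := (h.mem_H A hA g).1 hg
  have : a ∈ B ⊔ C := by
    have := (B ⊔ C).mul_mem hg' ((B ⊔ C).inv_mem (Subgroup.mem_sup_right hc))
    simpa using this
  have := h.inter A hA B hB hne a ha this
  subst this
  simpa using hc

open Classical in
/-- Summation over the partition. -/
theorem cover (h : ASConf t F C) (x : K) : ∃ A ∈ F, x ∈ A ⊔ C := by
  let S : Subgroup K → Finset K := fun A => Finset.univ.filter (fun x => x ∈ A ⊔ C ∧ x ∉ C)
  have hS : ∀ A ∈ F, (S A).card = t ^ 2 - t := by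
    intro A hA
    have : S A = (Finset.univ.filter (fun x => x ∈ A ⊔ C)) \ (Finset.univ.filter (fun x => x ∈ C)) := by
      ext x; simp [S]
    rw [this, Finset.card_sdiff_of_subset]
    · have h1 := h.card_H A hA
      have h2 := h.card_C
      rw [Nat.card_eq_fintype_card, Fintype.card_subtype] at h1 h2
      rw [h1, h2]
    · intro x; simp only [Finset.mem_filter, Finset.mem_univ, true_and]
      exact fun hx => Subgroup.mem_sup_right hx
  have hdis : ∀ A ∈ F, ∀ B ∈ F, A ≠ B → Disjoint (S A) (S B) := by
    intro A hA B hB hne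
    rw [Finset.disjoint_left]
    intro x hx hx'
    simp only [S, Finset.mem_filter, Finset.mem_univ, true_and] at hx hx'
    exact hx.2 (h.H_inter hA hB hne hx.1 hx'.1)
  have hU : (F.biUnion S).card = (t + 1) * (t ^ 2 - t) := by
    rw [Finset.card_biUnion hdis, Finset.sum_congr rfl hS, Finset.sum_const, h.card_F]; simp
  by_cases hxC : x ∈ C
  · obtain ⟨A, hA, -⟩ := h.exists_ne ⊥
    exact ⟨A, hA, Subgroup.mem_sup_right hxC⟩
  have hd2 : Disjoint (F.biUnion S) (Finset.univ.filter (fun x => x ∈ C)) := by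
    rw [Finset.disjoint_left]
    intro x hx hx'
    simp only [S, Finset.mem_biUnion, Finset.mem_filter, Finset.mem_univ, true_and] at hx hx'
    obtain ⟨_, _, _, h3⟩ := hx
    exact h3 hx'
  have hall : (F.biUnion S ∪ Finset.univ.filter (fun x => x ∈ C)) = Finset.univ := by
    rw [← Finset.card_eq_iff_eq_univ, Finset.card_union_of_disjoint hd2, hU]
    have h2 := h.card_C
    have h3 := h.card_K
    rw [Nat.card_eq_fintype_card] at h3
    rw [Nat.card_eq_fintype_card, Fintype.card_subtype] at h2
    rw [h2, h3]
    have : t ≤ t ^ 2 := by nlinarith [h.two_le]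
    zify [this]; ring
  have hx := Finset.mem_univ x
  rw [← hall, Finset.mem_union, Finset.mem_biUnion] at hx
  rcases hx with ⟨A, hA, hx⟩ | hx
  · exact ⟨A, hA, by simp [S] at hx; exact hx.1⟩
  · simp at hx; exact absurd hx hxC

/-- Product of two subgroups with trivial intersection. -/
theorem mul_surj {K : Type*} [Group K] [Fintype K] {X Y : Subgroup K}
    (hXY : ∀ x ∈ X, x ∈ Y → x = 1) (hc : Nat.card X * Nat.card Y = Nat.card K) (g : K) :
    ∃ x ∈ X, ∃ y ∈ Y, g = x * y := by
  classical
  let f : X × Y → K := fun p => p.1 * p.2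
  have hf : Function.Injective f := by
    rintro ⟨x, y⟩ ⟨x', y'⟩ hxy
    simp only [f] at hxy
    have h1 : (x' : K)⁻¹ * x = y' * (y : K)⁻¹ := by
      rw [eq_mul_inv_iff_mul_eq, mul_assoc, hxy]; group
    have h2 := hXY _ (X.mul_mem (X.inv_mem x'.2) x.2) (h1 ▸ Y.mul_mem y'.2 (Y.inv_mem y.2))
    have h3 : (x : K) = x' := by rw [inv_mul_eq_one] at h2; exact h2.symm
    rw [h3] at hxy
    have h4 := mul_left_cancel hxy
    exact Prod.ext (Subtype.ext h3) (Subtype.ext h4)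
  have hb : Function.Bijective f := by
    rw [Fintype.bijective_iff_injective_and_card]
    refine ⟨hf, ?_⟩
    rw [Fintype.card_prod, ← Nat.card_eq_fintype_card, ← Nat.card_eq_fintype_card,
      ← Nat.card_eq_fintype_card, hc]
  obtain ⟨⟨x, y⟩, hxy⟩ := hb.2 g
  exact ⟨x, x.2, y, y.2, hxy.symm⟩

theorem factor (h : ASConf t F C) {A B : Subgroup K} (hA : A ∈ F) (hB : B ∈ F) (hne : A ≠ B)
    (g : K) : ∃ a ∈ A, ∃ y ∈ B ⊔ C, g = a * y := by
  apply mul_surj (fun x hx hx' => h.inter A hA B hB hne x hx hx')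
  rw [h.card_A A hA, h.card_H B hB, h.card_K]; ring

theorem H_conj (h : ASConf t F C) {A : Subgroup K} (hA : A ∈ F) {x : K} (hx : x ∈ A ⊔ C) (g : K) :
    g⁻¹ * x * g ∈ A ⊔ C := by
  obtain ⟨B, hB, hxB⟩ := h.cover (g⁻¹ * x * g)
  by_cases hne : A = B
  · subst hne; exact hxB
  obtain ⟨a, ha, y, hy, rfl⟩ := h.factor hA hB hne g
  -- conj back by y
  have h1 : y * ((a * y)⁻¹ * x * (a * y)) * y⁻¹ ∈ B ⊔ C :=
    (B ⊔ C).mul_mem ((B ⊔ C).mul_mem hy hxB) ((B ⊔ C).inv_mem hy)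
  have h2 : y * ((a * y)⁻¹ * x * (a * y)) * y⁻¹ = a⁻¹ * x * a := by group
  rw [h2] at h1
  have ha' : a ∈ A ⊔ C := Subgroup.mem_sup_left ha
  have h3 := h.H_inter hA hB hne ((A ⊔ C).mul_mem ((A ⊔ C).mul_mem ((A ⊔ C).inv_mem ha') hx) ha') h1
  have h4 : (a * y)⁻¹ * x * (a * y) = y⁻¹ * (a⁻¹ * x * a) * y := by group
  rw [h4]
  exact Subgroup.mem_sup_right (by simpa using h.normal.conj_mem _ h3 y⁻¹)

theorem comm_HH (h : ASConf t F C) {A B : Subgroup K} (hA : A ∈ F) (hB : B ∈ F) (hne : A ≠ B)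
    {x y : K} (hx : x ∈ A ⊔ C) (hy : y ∈ B ⊔ C) : ⁅x, y⁆ ∈ C := by
  apply h.H_inter hA hB hne
  · rw [commutatorElement_def, mul_assoc, mul_assoc]
    apply (A ⊔ C).mul_mem hx
    have := h.H_conj hA ((A ⊔ C).inv_mem hx) y⁻¹
    simpa [mul_assoc] using this
  · rw [commutatorElement_def]
    apply (B ⊔ C).mul_mem _ ((B ⊔ C).inv_mem hy)
    have := h.H_conj hB hy x⁻¹
    simpa [mul_assoc] using this

theorem comm_mem (h : ASConf t F C) (x y : K) : ⁅x, y⁆ ∈ C := by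
  obtain ⟨A, hA, hx⟩ := h.cover x
  obtain ⟨B, hB, hBA⟩ := h.exists_ne A
  obtain ⟨D, hD, hDA, hDB⟩ := h.exists_ne2 A B
  obtain ⟨b, hb, d, hd, rfl⟩ := h.factor hB hD hDB.symm y
  have e : ⁅x, b * d⁆ = ⁅x, b⁆ * (b * ⁅x, d⁆ * b⁻¹) := by
    simp only [commutatorElement_def]; group
  rw [e]
  exact C.mul_mem (h.comm_HH hA hB hBA.symm hx (Subgroup.mem_sup_left hb))
    (h.normal.conj_mem _ (h.comm_HH hA hD hDA.symm hx hd) b)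

theorem commutator_le (h : ASConf t F C) : commutator K ≤ C := by
  rw [commutator_def, Subgroup.commutator_le]
  exact fun x _ y _ => h.comm_mem x y

theorem sq_mem_aux (h : ASConf t F C) {A B : Subgroup K} (hA : A ∈ F) (hB : B ∈ F) (hne : A ≠ B)
    {x : K} (hx : x ∈ A ⊔ C) : x ^ 2 ∈ C := by
  have h2 : 2 ∣ Nat.card B := by rw [h.card_A B hB]; exact h.even.two_dvd
  haveI : Fact (Nat.Prime 2) := ⟨Nat.prime_two⟩
  obtain ⟨⟨y, hyB⟩, hy⟩ := exists_prime_orderOf_dvd_card' 2 h2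
  have hy2 : y ^ 2 = 1 := by
    have := pow_orderOf_eq_one (⟨y, hyB⟩ : B)
    rw [hy] at this
    simpa using congrArg Subtype.val this
  have hy1 : y ≠ 1 := by
    rintro rfl
    rw [show (⟨1, hyB⟩ : B) = 1 from rfl, orderOf_one] at hy
    omega
  obtain ⟨D, hD, hxy⟩ := h.cover (x * y)
  have hDA : A ≠ D := by
    rintro rfl
    have : y ∈ A ⊔ C := by simpa using (A ⊔ C).mul_mem ((A ⊔ C).inv_mem hx) hxy
    exact hy1 (h.inter B hB A hA hne.symm y hyB this)
  have h3 : x ^ 2 ∈ D ⊔ C := by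
    have e : x ^ 2 = (x * y) ^ 2 * ((y ^ 2)⁻¹ * ⁅x⁻¹, y⁆⁻¹) := by
      simp only [commutatorElement_def, pow_two]; group
    rw [e, hy2]
    simp only [inv_one, one_mul]
    apply (D ⊔ C).mul_mem ((D ⊔ C).pow_mem hxy 2)
    apply Subgroup.mem_sup_right
    exact C.inv_mem (h.comm_mem x⁻¹ y)
  exact h.H_inter hA hD hDA ((A ⊔ C).pow_mem hx 2) h3

theorem sq_mem (h : ASConf t F C) (x : K) : x ^ 2 ∈ C := by
  obtain ⟨A, hA, hx⟩ := h.cover x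
  obtain ⟨B, hB, hBA⟩ := h.exists_ne A
  exact h.sq_mem_aux hA hB hBA.symm hx

theorem sq_A (h : ASConf t F C) {A : Subgroup K} (hA : A ∈ F) {a : K} (ha : a ∈ A) : a ^ 2 = 1 :=
  h.A_inter_C hA (A.pow_mem ha 2) (h.sq_mem a)

theorem exists_pow (h : ASConf t F C) : ∃ m, t = 2 ^ m := by
  obtain ⟨A, hA, -⟩ := h.exists_ne ⊥
  haveI : Fact (Nat.Prime 2) := ⟨Nat.prime_two⟩
  have : IsPGroup 2 A := by
    rintro ⟨a, ha⟩
    exact ⟨1, by ext; simpa using h.sq_A hA ha⟩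
  obtain ⟨m, hm⟩ := IsPGroup.iff_card.1 this
  exact ⟨m, by rw [← h.card_A A hA, hm]⟩

theorem isPGroup (h : ASConf t F C) : IsPGroup 2 K := by
  haveI : Fact (Nat.Prime 2) := ⟨Nat.prime_two⟩
  obtain ⟨m, hm⟩ := h.exists_pow
  exact IsPGroup.of_card (n := m * 3) (by rw [h.card_K, hm, pow_mul])

end ASConf

open Classical in
/-- The finset of elements of a subgroup. -/
noncomputable def fsub {K : Type*} [Group K] [Fintype K] (X : Subgroup K) : Finset K :=
  Finset.univ.filter (fun x => x ∈ X)

theorem mem_fsub {K : Type*} [Group K] [Fintype K] {X : Subgroup K} {x : K} :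
    x ∈ fsub X ↔ x ∈ X := by simp [fsub]

theorem card_fsub {K : Type*} [Group K] [Fintype K] (X : Subgroup K) :
    (fsub X).card = Nat.card X := by
  classical
  rw [Nat.card_eq_fintype_card, Fintype.card_subtype, fsub]

theorem fsub_nonempty {K : Type*} [Group K] [Fintype K] (X : Subgroup K) : (fsub X).Nonempty :=
  ⟨1, mem_fsub.2 X.one_mem⟩

/-- Translation invariance of sums over a subgroup. -/
theorem sum_fsub_mul_left {K : Type*} [Group K] [Fintype K] {R : Type*} [AddCommMonoid R]
    (X : Subgroup K) (f : K → R) {g : K} (hg : g ∈ X) :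
    ∑ x ∈ fsub X, f (g * x) = ∑ x ∈ fsub X, f x := by
  refine Finset.sum_bij (fun x _ => g * x) ?_ ?_ ?_ ?_
  · intro x hx; exact mem_fsub.2 (X.mul_mem hg (mem_fsub.1 hx))
  · intro x _ y _ h; exact mul_left_cancel h
  · intro y hy
    exact ⟨g⁻¹ * y, mem_fsub.2 (X.mul_mem (X.inv_mem hg) (mem_fsub.1 hy)), by group⟩
  · intro x _; rfl

theorem sum_fsub_mul_right {K : Type*} [Group K] [Fintype K] {R : Type*} [AddCommMonoid R]
    (X : Subgroup K) (f : K → R) {g : K} (hg : g ∈ X) :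
    ∑ x ∈ fsub X, f (x * g) = ∑ x ∈ fsub X, f x := by
  refine Finset.sum_bij (fun x _ => x * g) ?_ ?_ ?_ ?_
  · intro x hx; exact mem_fsub.2 (X.mul_mem (mem_fsub.1 hx) hg)
  · intro x _ y _ h; exact mul_right_cancel h
  · intro y hy
    exact ⟨y * g⁻¹, mem_fsub.2 (X.mul_mem (mem_fsub.1 hy) (X.inv_mem hg)), by group⟩
  · intro x _; rfl

namespace ASConf
variable {K : Type*} [Group K] [Fintype K] {t : ℕ} {F : Finset (Subgroup K)} {C : Subgroup K}

open Classical in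
/-- The key partition identity: `K ∖ H_A` is the disjoint union of the `a * (B ∖ 1)`. -/
theorem key_sum (h : ASConf t F C) {A : Subgroup K} (hA : A ∈ F) {R : Type*} [AddCommMonoid R]
    (f : K → R) :
    ∑ a ∈ fsub A, ∑ B ∈ F.erase A, ∑ g ∈ (fsub B).erase 1, f (a * g) =
      ∑ x ∈ Finset.univ \ fsub (A ⊔ C), f x := by
  let T : Finset K := (F.erase A).biUnion (fun B => (fsub B).erase 1)
  have hdis : ∀ B ∈ F.erase A, ∀ D ∈ F.erase A, B ≠ D →
      Disjoint ((fsub B).erase 1) ((fsub D).erase 1) := by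
    intro B hB D hD hne
    rw [Finset.disjoint_left]
    intro x hx hx'
    rw [Finset.mem_erase, mem_fsub] at hx hx'
    exact hx.1 (h.A_inter_A (Finset.mem_of_mem_erase hB) (Finset.mem_of_mem_erase hD) hne hx.2 hx'.2)
  have h1 : ∀ a : K, ∑ B ∈ F.erase A, ∑ g ∈ (fsub B).erase 1, f (a * g) = ∑ g ∈ T, f (a * g) := by
    intro a
    rw [Finset.sum_biUnion hdis]
  have hTcard : T.card = t * (t - 1) := by
    rw [Finset.card_biUnion hdis]
    have : ∀ B ∈ F.erase A, ((fsub B).erase 1).card = t - 1 := by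
      intro B hB
      rw [Finset.card_erase_of_mem (mem_fsub.2 B.one_mem), card_fsub,
        h.card_A B (Finset.mem_of_mem_erase hB)]
    rw [Finset.sum_congr rfl this, Finset.sum_const, Finset.card_erase_of_mem hA, h.card_F]
    simp
  have hT : ∀ x, x ∈ T ↔ ∃ B ∈ F, B ≠ A ∧ x ∈ B ∧ x ≠ 1 := by
    intro x
    simp only [T, Finset.mem_biUnion, Finset.mem_erase, mem_fsub]
    constructor
    · rintro ⟨B, ⟨h1, h2⟩, h3, h4⟩; exact ⟨B, h2, h1, h4, h3⟩
    · rintro ⟨B, h1, h2, h3, h4⟩; exact ⟨B, ⟨h2, h1⟩, h4, h3⟩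
  simp_rw [h1]
  rw [← Finset.sum_product']
  have hinj : Set.InjOn (fun p : K × K => p.1 * p.2) (fsub A ×ˢ T : Finset (K × K)) := by
    rintro ⟨a, x⟩ hp ⟨a', x'⟩ hp' hxy
    simp only [Finset.coe_product, Set.mem_prod, Finset.mem_coe, mem_fsub, hT] at hp hp' hxy
    obtain ⟨ha, B, hB, hBA, hxB, hx1⟩ := hp
    obtain ⟨ha', D, hD, hDA, hxD, hx1'⟩ := hp'
    have e : a'⁻¹ * a * x = x' := by rw [mul_assoc, hxy]; group
    by_cases hBD : B = D
    · subst hBD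
      have e2 : a'⁻¹ * a ∈ B := by
        have : a'⁻¹ * a = x' * x⁻¹ := by rw [← e]; group
        rw [this]; exact B.mul_mem hxD (B.inv_mem hxB)
      have e3 := h.A_inter_A hA hB hBA.symm (A.mul_mem (A.inv_mem ha') ha) e2
      rw [e3, one_mul] at e
      rw [inv_mul_eq_one] at e3
      rw [e, e3]
    · have := h.prod A hA B hB D hD hBA.symm hBD hDA.symm _ (A.mul_mem (A.inv_mem ha') ha) x hxB
        (by rw [e]; exact hxD)
      rw [e] at this
      exact absurd this hx1'
  have himg : (fsub A ×ˢ T).image (fun p : K × K => p.1 * p.2) = Finset.univ \ fsub (A ⊔ C) := by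
    apply Finset.eq_of_subset_of_card_le
    · intro y hy
      simp only [Finset.mem_image, Finset.mem_product, mem_fsub, hT, Prod.exists] at hy
      obtain ⟨a, x, ⟨ha, B, hB, hBA, hxB, hx1⟩, rfl⟩ := hy
      simp only [Finset.mem_sdiff, Finset.mem_univ, true_and, mem_fsub]
      intro hm
      apply hx1
      apply h.inter B hB A hA hBA x hxB
      simpa using (A ⊔ C).mul_mem ((A ⊔ C).inv_mem (Subgroup.mem_sup_left ha)) hm
    · rw [Finset.card_image_of_injOn hinj, Finset.card_product, hTcard, card_fsub, h.card_A A hA,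
        Finset.card_sdiff_of_subset (Finset.subset_univ _), card_fsub, h.card_H A hA,
        Finset.card_univ, ← Nat.card_eq_fintype_card, h.card_K]
      obtain ⟨s, rfl⟩ : ∃ s, t = s + 1 := ⟨t - 1, by have := h.two_le; omega⟩
      simp only [Nat.add_sub_cancel]
      apply Nat.sub_le_of_le_add
      nlinarith
  rw [← himg, Finset.sum_image hinj]

/-- Existence form of the partition identity. -/
theorem key_exists (h : ASConf t F C) {A : Subgroup K} (hA : A ∈ F) {x : K} (hx : x ∉ A ⊔ C) :
    ∃ a ∈ A, ∃ B ∈ F, B ≠ A ∧ a * x ∈ B := by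
  classical
  by_contra hcon
  push Not at hcon
  have h1 := h.key_sum hA (fun y => if y = x then (1 : ℕ) else 0)
  rw [Finset.sum_ite_eq', if_pos (by simp [mem_fsub, hx])] at h1
  rw [Finset.sum_eq_zero] at h1
  · omega
  · intro a ha
    apply Finset.sum_eq_zero
    intro B hB
    apply Finset.sum_eq_zero
    intro g hg
    rw [Finset.mem_erase] at hB hg
    rw [mem_fsub] at ha hg
    rw [if_neg]
    rintro rfl
    apply hcon a⁻¹ (A.inv_mem ha) B hB.2 hB.1
    simpa using hg.2

end ASConf

/-- The sign character of `ZMod 2`. -/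
def sg (x : ZMod 2) : ℤ := if x = 0 then 1 else -1

theorem sg_add (x y : ZMod 2) : sg (x + y) = sg x * sg y := by
  revert x y; decide

theorem sg_zero : sg 0 = 1 := rfl
theorem sg_of_ne {x : ZMod 2} (h : x ≠ 0) : sg x = -1 := by simp [sg, h]
theorem zmod2_add_self (x : ZMod 2) : x + x = 0 := by revert x; decide
theorem sg_ge (x : ZMod 2) : -1 ≤ sg x := by revert x; decide
theorem sg_le (x : ZMod 2) : sg x ≤ 1 := by revert x; decide

theorem sum_sg_zero {K : Type*} [Group K] [Fintype K] (X : Subgroup K) (f : K → ZMod 2)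
    (hf : ∀ x ∈ X, ∀ y ∈ X, f (x * y) = f x + f y) {z : K} (hz : z ∈ X) (hz0 : f z ≠ 0) :
    ∑ x ∈ fsub X, sg (f x) = 0 := by
  have h1 := sum_fsub_mul_left X (fun x => sg (f x)) hz
  have h2 : ∑ x ∈ fsub X, sg (f (z * x)) = - ∑ x ∈ fsub X, sg (f x) := by
    rw [← Finset.sum_neg_distrib]
    apply Finset.sum_congr rfl
    intro x hx
    rw [hf z hz x (mem_fsub.1 hx), sg_add, sg_of_ne hz0]; ring
  omega

theorem sum_sg_card {K : Type*} [Group K] [Fintype K] (X : Subgroup K) (f : K → ZMod 2)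
    (hf : ∀ x ∈ X, f x = 0) :
    ∑ x ∈ fsub X, sg (f x) = Nat.card X := by
  rw [Finset.sum_congr rfl (g := fun _ => (1 : ℤ)), Finset.sum_const, card_fsub]
  · simp
  · intro x hx; rw [hf x (mem_fsub.1 hx), sg_zero]

theorem two_mul_card_le {K : Type*} [Group K] [Fintype K] {X Y : Subgroup K} (hXY : X ≤ Y)
    {y : K} (hy : y ∈ Y) (hy' : y ∉ X) : 2 * Nat.card X ≤ Nat.card Y := by
  obtain ⟨k, hk⟩ := Subgroup.card_dvd_of_le hXY
  have hY : 0 < Nat.card Y := Nat.card_pos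
  have : k ≠ 0 := by rintro rfl; omega
  have : k ≠ 1 := by
    rintro rfl
    have : X = Y := Subgroup.eq_of_le_of_card_ge hXY (by omega)
    exact hy' (this ▸ hy)
  have : 2 ≤ k := by omega
  rw [hk]; nlinarith

namespace ASConf
variable {K : Type*} [Group K] [Fintype K] {t : ℕ} {F : Finset (Subgroup K)} {C : Subgroup K}

/-- Sum over `H_A = A C`. -/
theorem sum_H (h : ASConf t F C) {A : Subgroup K} (hA : A ∈ F) {R : Type*} [AddCommMonoid R]
    (f : K → R) :
    ∑ x ∈ fsub (A ⊔ C), f x = ∑ a ∈ fsub A, ∑ c ∈ fsub C, f (a * c) := by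
  classical
  rw [← Finset.sum_product']
  symm
  refine Finset.sum_bij (fun p _ => p.1 * p.2) ?_ ?_ ?_ ?_
  · rintro ⟨a, c⟩ hp
    simp only [Finset.mem_product, mem_fsub] at hp ⊢
    exact (A ⊔ C).mul_mem (Subgroup.mem_sup_left hp.1) (Subgroup.mem_sup_right hp.2)
  · rintro ⟨a, c⟩ hp ⟨a', c'⟩ hp' e
    simp only [Finset.mem_product, mem_fsub] at hp hp' e
    have h1 : a'⁻¹ * a = c' * c⁻¹ := by
      rw [eq_mul_inv_iff_mul_eq, mul_assoc, e]; group
    have h2 := h.A_inter_C hA (A.mul_mem (A.inv_mem hp'.1) hp.1)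
      (h1 ▸ C.mul_mem hp'.2 (C.inv_mem hp.2))
    have h3 : a = a' := by rw [inv_mul_eq_one] at h2; exact h2.symm
    subst h3
    rw [mul_left_cancel e]
  · intro x hx
    obtain ⟨a, ha, c, hc, rfl⟩ := (h.mem_H A hA x).1 (mem_fsub.1 hx)
    exact ⟨(a, c), by simp [mem_fsub, ha, hc], rfl⟩
  · intro _ _; rfl

/-- Sum over all of `K`. -/
theorem sum_K (h : ASConf t F C) (f : K → ℤ) :
    ∑ x, f x = ∑ A ∈ F, ∑ x ∈ fsub (A ⊔ C), f x - t * ∑ c ∈ fsub C, f c := by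
  classical
  have hsub : ∀ A : Subgroup K, fsub C ⊆ fsub (A ⊔ C) := fun A x hx =>
    mem_fsub.2 (Subgroup.mem_sup_right (mem_fsub.1 hx))
  have h1 : (Finset.univ : Finset K) \ fsub C = F.biUnion (fun A => fsub (A ⊔ C) \ fsub C) := by
    ext x
    simp only [Finset.mem_sdiff, Finset.mem_univ, true_and, mem_fsub, Finset.mem_biUnion]
    constructor
    · intro hx
      obtain ⟨A, hA, hxA⟩ := h.cover x
      exact ⟨A, hA, hxA, hx⟩
    · rintro ⟨A, _, _, hx⟩; exact hx
  have h2 : ∑ x ∈ (Finset.univ : Finset K) \ fsub C, f x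
      = ∑ A ∈ F, ∑ x ∈ fsub (A ⊔ C) \ fsub C, f x := by
    rw [h1, Finset.sum_biUnion]
    intro A hA B hB hne
    simp only [Function.onFun]
    rw [Finset.disjoint_left]
    intro x hx hx'
    simp only [Finset.mem_sdiff, mem_fsub] at hx hx'
    exact hx.2 (h.H_inter hA hB hne hx.1 hx'.1)
  have h3 := Finset.sum_sdiff (f := f) (Finset.subset_univ (fsub C))
  have h4 : ∀ A ∈ F, ∑ x ∈ fsub (A ⊔ C) \ fsub C, f x
      = ∑ x ∈ fsub (A ⊔ C), f x - ∑ c ∈ fsub C, f c := by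
    intro A _
    have := Finset.sum_sdiff (f := f) (hsub A)
    linarith
  rw [h2, Finset.sum_congr rfl h4, Finset.sum_sub_distrib, Finset.sum_const, h.card_F] at h3
  rw [← h3]; simp; ring

end ASConf

/-- The quadratic form data attached to a configuration. -/
structure QF {K : Type*} [Group K] [Fintype K] (t : ℕ) (F : Finset (Subgroup K))
    (C : Subgroup K) (q : K → ZMod 2) (β : K → K → ZMod 2) : Prop where
  conf : ASConf t F C
  mul_left : ∀ x y z, β (x * y) z = β x z + β y z
  symm : ∀ x y, β x y = β y x
  self : ∀ x, β x x = 0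
  q_mul : ∀ x y, q (x * y) = q x + q y + β x y
  q_A : ∀ A ∈ F, ∀ a ∈ A, q a = 0
  ne : ∃ x y, β x y ≠ 0
  CZ : ∃ z ∈ C, z ≠ 1 ∧ ∀ y, β z y = 0

namespace QF
variable {K : Type*} [Group K] [Fintype K] {t : ℕ} {F : Finset (Subgroup K)} {C : Subgroup K}
  {q : K → ZMod 2} {β : K → K → ZMod 2}

theorem mul_right (h : QF t F C q β) (x y z : K) : β x (y * z) = β x y + β x z := by
  rw [h.symm, h.mul_left, h.symm y, h.symm z]

theorem one_left (h : QF t F C q β) (x : K) : β 1 x = 0 := by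
  have := h.mul_left 1 1 x
  simpa using this

theorem one_right (h : QF t F C q β) (x : K) : β x 1 = 0 := by rw [h.symm, h.one_left]

theorem inv_left (h : QF t F C q β) (x y : K) : β x⁻¹ y = β x y := by
  have := h.mul_left x⁻¹ x y
  rw [inv_mul_cancel, h.one_left] at this
  have h2 := zmod2_add_self (β x y)
  exact add_right_cancel (this.symm.trans h2.symm)

/-- The orthogonal subgroup. -/
def perp (h : QF t F C q β) (X : Subgroup K) : Subgroup K where
  carrier := {x | ∀ s ∈ X, β x s = 0}
  mul_mem' := by
    intro a b ha hb s hs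
    rw [h.mul_left, ha s hs, hb s hs, add_zero]
  one_mem' := fun s _ => h.one_left s
  inv_mem' := by
    intro a ha s hs
    rw [h.inv_left, ha s hs]

theorem mem_perp (h : QF t F C q β) {X : Subgroup K} {x : K} :
    x ∈ h.perp X ↔ ∀ s ∈ X, β x s = 0 := Iff.rfl

/-- The radical. -/
def Z (h : QF t F C q β) : Subgroup K := h.perp ⊤

theorem mem_Z (h : QF t F C q β) {x : K} : x ∈ h.Z ↔ ∀ s, β x s = 0 := by
  simp [Z, mem_perp]

theorem Z_le_perp (h : QF t F C q β) (X : Subgroup K) : h.Z ≤ h.perp X :=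
  fun _ hx s _ => h.mem_Z.1 hx s

theorem isotropic (h : QF t F C q β) {X : Subgroup K} (hX : ∀ x ∈ X, q x = 0) {x y : K}
    (hx : x ∈ X) (hy : y ∈ X) : β x y = 0 := by
  have := h.q_mul x y
  rw [hX x hx, hX y hy, hX _ (X.mul_mem hx hy)] at this
  simpa using this.symm

theorem A_le_perp (h : QF t F C q β) {A : Subgroup K} (hA : A ∈ F) : A ≤ h.perp A :=
  fun _ hx _ hy => h.isotropic (h.q_A A hA) hx hy

theorem sum_beta (h : QF t F C q β) (X : Subgroup K) (k : K) [Decidable (k ∈ h.perp X)] :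
    ∑ x ∈ fsub X, sg (β k x) = if k ∈ h.perp X then (Nat.card X : ℤ) else 0 := by
  split_ifs with hk
  · exact sum_sg_card X _ hk
  · rw [mem_perp] at hk
    push Not at hk
    obtain ⟨s, hs, hs0⟩ := hk
    exact sum_sg_zero X _ (fun x _ y _ => h.mul_right k x y) hs hs0

theorem fsub_top : fsub (⊤ : Subgroup K) = Finset.univ := by
  ext; simp [mem_fsub]

theorem sum_ite_fsub (X Y : Subgroup K) [DecidablePred (· ∈ Y)] (n : ℤ) :
    ∑ x ∈ fsub X, (if x ∈ Y then n else 0) = Nat.card (X ⊓ Y : Subgroup K) * n := by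
  classical
  rw [← Finset.sum_filter, Finset.sum_const, ← card_fsub]
  rw [show (fsub X).filter (· ∈ Y) = fsub (X ⊓ Y) by ext; simp [mem_fsub]]
  simp

/-- Duality. -/
theorem duality (h : QF t F C q β) (X : Subgroup K) :
    Nat.card (h.perp X) * Nat.card X = Nat.card (X ⊓ h.Z : Subgroup K) * t ^ 3 := by
  classical
  have h1 : ∑ k ∈ fsub (⊤ : Subgroup K), ∑ x ∈ fsub X, sg (β k x)
      = Nat.card (h.perp X) * Nat.card X := by
    rw [Finset.sum_congr rfl (fun k _ => h.sum_beta X k), sum_ite_fsub, top_inf_eq]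
  have h2 : ∑ x ∈ fsub X, ∑ k ∈ fsub (⊤ : Subgroup K), sg (β k x)
      = Nat.card (X ⊓ h.Z : Subgroup K) * t ^ 3 := by
    have : ∀ x ∈ fsub X, ∑ k ∈ fsub (⊤ : Subgroup K), sg (β k x)
        = if x ∈ h.Z then (t ^ 3 : ℤ) else 0 := by
      intro x _
      simp_rw [h.symm _ x]
      rw [h.sum_beta ⊤ x, Subgroup.card_top, h.conf.card_K]
      simp only [Z, Nat.cast_pow]
      congr
    rw [Finset.sum_congr rfl this, sum_ite_fsub]
  rw [Finset.sum_comm, h2] at h1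
  exact_mod_cast h1.symm

/-- F1. -/
theorem q_perp (h : QF t F C q β) {A : Subgroup K} (hA : A ∈ F) {x : K} (hx : x ∈ h.perp A)
    (hxH : x ∉ A ⊔ C) : q x = 0 := by
  obtain ⟨a, ha, B, hB, hBA, hab⟩ := h.conf.key_exists hA hxH
  have := h.q_A B hB _ hab
  rw [h.q_mul, h.q_A A hA a ha, h.symm, hx a ha] at this
  simpa using this

open Classical in
/-- F2. -/
theorem card_perp_le (h : QF t F C q β) {x : K} (hx : x ∉ h.Z) :
    (F.filter (fun A => x ∈ h.perp A)).card ≤ 2 := by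
  by_contra hcon
  push Not at hcon
  have hne : (F.filter (fun A => x ∈ h.perp A)).Nonempty := Finset.card_pos.1 (by omega)
  obtain ⟨A, hAm⟩ := hne
  rw [Finset.mem_filter] at hAm
  obtain ⟨hA, hxA⟩ := hAm
  have ht := h.conf.two_le
  have h1 := h.conf.key_sum hA (fun y => sg (β x y))
  have hsumB : ∀ B ∈ F.erase A, ∑ g ∈ (fsub B).erase 1, sg (β x g)
      = (if x ∈ h.perp B then (t : ℤ) else 0) - 1 := by
    intro B hB
    have e := Finset.add_sum_erase (fsub B) (fun g => sg (β x g)) (mem_fsub.2 B.one_mem)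
    simp only [h.one_right, sg_zero] at e
    rw [h.sum_beta, h.conf.card_A B (Finset.mem_of_mem_erase hB)] at e
    linarith
  have hL : ∑ a ∈ fsub A, ∑ B ∈ F.erase A, ∑ g ∈ (fsub B).erase 1, sg (β x (a * g))
      = t * (((F.erase A).filter (fun B => x ∈ h.perp B)).card * t - t) := by
    have : ∀ a ∈ fsub A, ∑ B ∈ F.erase A, ∑ g ∈ (fsub B).erase 1, sg (β x (a * g))
        = ((F.erase A).filter (fun B => x ∈ h.perp B)).card * t - t := by
      intro a ha
      have e : ∀ g, sg (β x (a * g)) = sg (β x g) := by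
        intro g
        rw [h.mul_right, hxA a (mem_fsub.1 ha), zero_add]
      simp_rw [e]
      rw [Finset.sum_congr rfl hsumB, Finset.sum_sub_distrib, ← Finset.sum_filter,
        Finset.sum_const, Finset.sum_const, Finset.card_erase_of_mem hA, h.conf.card_F]
      simp
    rw [Finset.sum_congr rfl this, Finset.sum_const, card_fsub, h.conf.card_A A hA]
    simp
  have hK : ∑ y, sg (β x y) = 0 := by
    have := h.sum_beta ⊤ x
    rw [fsub_top, if_neg (by exact hx)] at this
    exact this
  have hH : 0 ≤ ∑ y ∈ fsub (A ⊔ C), sg (β x y) := by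
    rw [h.sum_beta]; split_ifs <;> positivity
  have hs := Finset.sum_sdiff (f := fun y => sg (β x y)) (Finset.subset_univ (fsub (A ⊔ C)))
  rw [hL] at h1
  have hcard : (F.filter (fun A => x ∈ h.perp A)).card
      = ((F.erase A).filter (fun B => x ∈ h.perp B)).card + 1 := by
    rw [Finset.filter_erase, Finset.card_erase_of_mem (by simp [hA, hxA])]
    omega
  set n := ((F.erase A).filter (fun B => x ∈ h.perp B)).card
  have hn : (2 : ℤ) ≤ n := by omega
  have ht' : (2 : ℤ) ≤ t := by exact_mod_cast ht
  have : 0 < (t : ℤ) * (n * t - t) := by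
    apply mul_pos (by linarith)
    nlinarith
  linarith

end QF

namespace QF
variable {K : Type*} [Group K] [Fintype K] {t : ℕ} {F : Finset (Subgroup K)} {C : Subgroup K}
  {q : K → ZMod 2} {β : K → K → ZMod 2}

theorem card_perp (h : QF t F C q β) {A : Subgroup K} (hA : A ∈ F) :
    Nat.card (h.perp A) = t ^ 2 * Nat.card (A ⊓ h.Z : Subgroup K) := by
  have h1 := h.duality A
  rw [h.conf.card_A A hA] at h1
  have ht : 0 < t := by have := h.conf.two_le; omega
  apply Nat.eq_of_mul_eq_mul_right ht
  rw [h1]; ring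

theorem card_perp_H (h : QF t F C q β) {A : Subgroup K} (hA : A ∈ F) :
    Nat.card (h.perp A ⊓ (A ⊔ C) : Subgroup K) = t * Nat.card (C ⊓ h.perp A : Subgroup K) := by
  classical
  have h1 := h.conf.sum_H hA (fun x => if x ∈ h.perp A then (1 : ℤ) else 0)
  rw [sum_ite_fsub] at h1
  have h2 : ∀ a ∈ fsub A, ∑ c ∈ fsub C, (if a * c ∈ h.perp A then (1 : ℤ) else 0)
      = Nat.card (C ⊓ h.perp A : Subgroup K) := by
    intro a ha
    have ha' := h.A_le_perp hA (mem_fsub.1 ha)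
    have := sum_ite_fsub C (h.perp A) 1
    rw [mul_one] at this
    rw [← this]
    apply Finset.sum_congr rfl
    intro c _
    simp only [Subgroup.mul_mem_cancel_left _ ha']
  rw [Finset.sum_congr rfl h2, Finset.sum_const, card_fsub, h.conf.card_A A hA, inf_comm] at h1
  simp only [mul_one, nsmul_eq_mul] at h1
  exact_mod_cast h1

theorem perp_perp_le (h : QF t F C q β) {A : Subgroup K} (hA : A ∈ F) :
    h.perp (h.perp A) ≤ h.perp A :=
  fun _ hx s hs => hx s (h.A_le_perp hA hs)

theorem card_perp_perp (h : QF t F C q β) {A : Subgroup K} (hA : A ∈ F) :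
    Nat.card (h.perp (h.perp A)) * Nat.card (A ⊓ h.Z : Subgroup K) = Nat.card h.Z * t := by
  have h1 := h.duality (h.perp A)
  rw [inf_eq_right.2 (h.Z_le_perp A), h.card_perp hA] at h1
  have ht : 0 < t := by have := h.conf.two_le; omega
  apply Nat.eq_of_mul_eq_mul_right (pow_pos ht 2)
  linarith

theorem rho_pos (h : QF t F C q β) (A : Subgroup K) : 0 < Nat.card (A ⊓ h.Z : Subgroup K) :=
  Nat.card_pos

theorem card_Z_le (h : QF t F C q β) {A : Subgroup K} (hA : A ∈ F) :
    Nat.card h.Z ≤ t * Nat.card (A ⊓ h.Z : Subgroup K) ^ 2 := by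
  have h1 := h.card_perp_perp hA
  have h2 := Subgroup.card_le_of_le (h.perp_perp_le hA)
  rw [h.card_perp hA] at h2
  have ht : 0 < t := by have := h.conf.two_le; omega
  apply Nat.le_of_mul_le_mul_right _ ht
  rw [← h1]
  nlinarith [Nat.mul_le_mul_right (Nat.card (A ⊓ h.Z : Subgroup K)) h2]

theorem q_eq_beta (h : QF t F C q β) {A : Subgroup K} (hA : A ∈ F) {x y : K} (hx : x ∈ h.perp A)
    (hxH : x ∉ A ⊔ C) (hy : y ∈ h.perp A) (hyH : y ∈ A ⊔ C) : q y = β x y := by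
  have h1 : q (x * y) = 0 := by
    apply h.q_perp hA ((h.perp A).mul_mem hx hy)
    rwa [Subgroup.mul_mem_cancel_right _ hyH]
  rw [h.q_mul, h.q_perp hA hx hxH, zero_add] at h1
  have h2 := zmod2_add_self (β x y)
  exact add_right_cancel (h1.trans h2.symm)

/-- Dichotomy: if `q` is nonzero on `perp A` then the index is at most two. -/
theorem dichotomy (h : QF t F C q β) {A : Subgroup K} (hA : A ∈ F) {y : K} (hy : y ∈ h.perp A)
    (hq : q y ≠ 0) :
    t * Nat.card (A ⊓ h.Z : Subgroup K) ≤ 2 * Nat.card (C ⊓ h.perp A : Subgroup K) := by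
  classical
  have ht : 0 < t := by have := h.conf.two_le; omega
  have hyH : y ∈ A ⊔ C := by
    by_contra hcon; exact hq (h.q_perp hA hy hcon)
  have key : Nat.card (h.perp A) ≤ 2 * Nat.card (h.perp A ⊓ (A ⊔ C) : Subgroup K) := by
    by_cases hx : ∃ x ∈ h.perp A, x ∉ A ⊔ C
    · obtain ⟨x, hx, hxH⟩ := hx
      have : fsub (h.perp A) ⊆ fsub (h.perp A ⊓ (A ⊔ C)) ∪
          (fsub (h.perp A ⊓ (A ⊔ C))).image (fun w => x * w) := by
        intro w hw
        rw [mem_fsub] at hw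
        rw [Finset.mem_union, Finset.mem_image]
        by_cases hwH : w ∈ A ⊔ C
        · left; exact mem_fsub.2 ⟨hw, hwH⟩
        · right
          refine ⟨x⁻¹ * w, mem_fsub.2 ⟨(h.perp A).mul_mem ((h.perp A).inv_mem hx) hw, ?_⟩, by group⟩
          by_contra hcon
          have e := h.q_eq_beta hA ((h.perp A).mul_mem ((h.perp A).inv_mem hx) hw) hcon hy hyH
          rw [h.mul_left, h.inv_left, ← h.q_eq_beta hA hx hxH hy hyH,
            ← h.q_eq_beta hA hw hwH hy hyH, zmod2_add_self] at e
          exact hq e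
      have h2 := Finset.card_le_card this
      have h3 := Finset.card_union_le (fsub (h.perp A ⊓ (A ⊔ C)))
        ((fsub (h.perp A ⊓ (A ⊔ C))).image (fun w => x * w))
      have h4 := Finset.card_image_le (s := fsub (h.perp A ⊓ (A ⊔ C))) (f := fun w => x * w)
      rw [card_fsub] at h2 h3 h4
      omega
    · push Not at hx
      have : h.perp A ≤ h.perp A ⊓ (A ⊔ C) := le_inf le_rfl hx
      have := Subgroup.card_le_of_le this
      omega
  rw [h.card_perp hA, h.card_perp_H hA] at key
  apply Nat.le_of_mul_le_mul_left _ ht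
  nlinarith

/-- Type I. -/
theorem typeI_self (h : QF t F C q β) {A : Subgroup K} (hA : A ∈ F)
    (hq : ∀ x ∈ h.perp A, q x = 0) : h.perp (h.perp A) = h.perp A :=
  le_antisymm (h.perp_perp_le hA) (fun _ hx _ hs => h.isotropic hq hx hs)

theorem typeI_card (h : QF t F C q β) {A : Subgroup K} (hA : A ∈ F)
    (hq : ∀ x ∈ h.perp A, q x = 0) :
    Nat.card h.Z = t * Nat.card (A ⊓ h.Z : Subgroup K) ^ 2 := by
  have h1 := h.card_perp_perp hA
  rw [h.typeI_self hA hq, h.card_perp hA] at h1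
  have ht : 0 < t := by have := h.conf.two_le; omega
  apply Nat.eq_of_mul_eq_mul_right ht
  rw [← h1]; ring

theorem gauss (h : QF t F C q β) {A : Subgroup K} (hA : A ∈ F)
    (hq : ∀ x ∈ h.perp A, q x = 0) :
    ∑ x, sg (q x) = Nat.card (h.perp A) := by
  classical
  have h1 : ∀ y ∈ fsub (h.perp A), ∑ x, sg (q x) = ∑ x, sg (q (x * y)) := by
    intro y _
    have := sum_fsub_mul_right ⊤ (fun x => sg (q x)) (Subgroup.mem_top y)
    rw [fsub_top] at this
    exact this.symm
  have h2 : ∑ y ∈ fsub (h.perp A), ∑ x, sg (q x) = Nat.card (h.perp A) * ∑ x, sg (q x) := by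
    rw [Finset.sum_const, card_fsub]; simp
  have h3 : ∀ x : K, ∑ y ∈ fsub (h.perp A), sg (q (x * y))
      = if x ∈ h.perp A then (Nat.card (h.perp A) : ℤ) else 0 := by
    intro x
    have : ∀ y ∈ fsub (h.perp A), sg (q (x * y)) = sg (q x) * sg (β x y) := by
      intro y hy
      rw [h.q_mul, hq y (mem_fsub.1 hy), add_zero, sg_add]
    rw [Finset.sum_congr rfl this, ← Finset.mul_sum, h.sum_beta]
    rw [h.typeI_self hA hq]
    split_ifs with hx
    · rw [hq x hx, sg_zero, one_mul]
    · simp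
  rw [Finset.sum_congr rfl h1, Finset.sum_comm, Finset.sum_congr rfl (fun x _ => h3 x)] at h2
  have h4 := sum_ite_fsub ⊤ (h.perp A) (Nat.card (h.perp A))
  rw [fsub_top, top_inf_eq] at h4
  rw [h4] at h2
  have : (0 : ℤ) < Nat.card (h.perp A) := by exact_mod_cast Nat.card_pos
  exact (mul_left_cancel₀ this.ne' h2).symm

theorem z_ge (h : QF t F C q β) : 2 ≤ Nat.card (C ⊓ h.Z : Subgroup K) := by
  obtain ⟨z, hzC, hz1, hz⟩ := h.CZ
  have := two_mul_card_le (X := ⊥) (Y := C ⊓ h.Z) bot_le (y := z) ⟨hzC, h.mem_Z.2 hz⟩ (by simpa)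
  simpa using this

theorem rho_lt (h : QF t F C q β) {A : Subgroup K} (hA : A ∈ F)
    (hq : ∀ x ∈ h.perp A, q x = 0) : Nat.card (A ⊓ h.Z : Subgroup K) < t := by
  by_contra hcon
  have e : A ⊓ h.Z = A := Subgroup.eq_of_le_of_card_ge inf_le_left
    (by rw [h.conf.card_A A hA]; omega)
  have hAZ : A ≤ h.Z := inf_eq_left.1 e
  have hall : ∀ x, q x = 0 := fun x => hq x (fun s hs => by
    rw [h.symm]; exact h.mem_Z.1 (hAZ hs) x)
  obtain ⟨x, y, hxy⟩ := h.ne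
  exact hxy (h.isotropic (X := ⊤) (fun x _ => hall x) trivial trivial)

/-- Case alpha. -/
theorem case_alpha (h : QF t F C q β) {A : Subgroup K} (hA : A ∈ F)
    (hgen : ¬ C ≤ h.perp A) {y : K} (hy : y ∈ h.perp A) (hq : q y ≠ 0) : False := by
  classical
  have ht := h.conf.two_le
  have hd := h.dichotomy hA hy hq
  obtain ⟨c, hc, hcp⟩ := Set.not_subset.1 hgen
  have hγ := two_mul_card_le (X := C ⊓ h.perp A) (Y := C) inf_le_left hc (fun hh => hcp hh.2)
  rw [h.conf.card_C] at hγ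
  have hρ := h.rho_pos A
  have hρ1 : Nat.card (A ⊓ h.Z : Subgroup K) = 1 := by nlinarith
  have hyH : y ∈ A ⊔ C := by
    by_contra hcon; exact hq (h.q_perp hA hy hcon)
  have hcp := h.card_perp hA
  have hch := h.card_perp_H hA
  rw [hρ1] at hcp hd
  have hx : ∃ x ∈ h.perp A, x ∉ A ⊔ C := by
    by_contra hcon
    push Not at hcon
    have : h.perp A ≤ h.perp A ⊓ (A ⊔ C) := le_inf le_rfl hcon
    have := Subgroup.card_le_of_le this
    rw [hcp, hch] at this
    nlinarith
  obtain ⟨x, hx, hxH⟩ := hx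
  have hxy : β x y ≠ 0 := by rw [← h.q_eq_beta hA hx hxH hy hyH]; exact hq
  let W : Subgroup K := h.perp A ⊓ h.perp (Subgroup.zpowers y)
  have hpW : h.perp (h.perp A) ≤ W := le_inf (h.perp_perp_le hA) (fun w hw s hs =>
    hw s ((Subgroup.zpowers_le.2 hy) hs))
  have hyW : y ∈ W := by
    refine ⟨hy, fun s hs => ?_⟩
    have : y ∈ h.perp (Subgroup.zpowers y) := by
      have : Subgroup.zpowers y ≤ h.perp (Subgroup.zpowers y) := by
        rw [Subgroup.zpowers_le]
        intro s hs
        rw [h.symm]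
        obtain ⟨n, rfl⟩ := Subgroup.mem_zpowers_iff.1 hs
        have h5 : ∀ n : ℕ, β (y ^ n) y = 0 := by
          intro n
          induction n with
          | zero => simp [h.one_left]
          | succ n ih => rw [pow_succ, h.mul_left, ih, h.self, add_zero]
        cases n with
        | ofNat n => simpa using h5 n
        | negSucc n => rw [zpow_negSucc, h.inv_left]; exact h5 _
      exact this (Subgroup.mem_zpowers y)
    exact this s hs
  have h1 := two_mul_card_le hpW hyW (fun hh => hxy (by rw [h.symm]; exact hh x hx))
  have h2 := two_mul_card_le (X := W) (Y := h.perp A) inf_le_left hx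
    (fun hh => hxy (hh.2 y (Subgroup.mem_zpowers y)))
  have h3 := h.card_perp_perp hA
  rw [hρ1, mul_one] at h3
  rw [h3] at h1
  rw [hcp] at h2
  have hZ : 4 * Nat.card h.Z ≤ t := by
    apply Nat.le_of_mul_le_mul_right _ (show 0 < t by omega)
    nlinarith
  have hall : ∀ A' ∈ F, t ≤ 2 * Nat.card (C ⊓ h.perp A' : Subgroup K) := by
    intro A' hA'
    by_cases hI : ∀ x ∈ h.perp A', q x = 0
    · have := h.typeI_card hA' hI
      have h7 := Nat.mul_le_mul_left t (Nat.one_le_pow 2 _ (h.rho_pos A'))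
      omega
    · push Not at hI
      obtain ⟨y', hy', hq'⟩ := hI
      have := h.dichotomy hA' hy' hq'
      have := h.rho_pos A'
      nlinarith
  have hz := h.z_ge
  have hzZ : Nat.card (C ⊓ h.Z : Subgroup K) ≤ Nat.card h.Z := Subgroup.card_le_of_le inf_le_right
  -- double count
  have e1 : ∑ A' ∈ F, (Nat.card (C ⊓ h.perp A' : Subgroup K) : ℤ)
      = ∑ c ∈ fsub C, ((F.filter (fun A' => c ∈ h.perp A')).card : ℤ) := by
    have : ∀ A' ∈ F, (Nat.card (C ⊓ h.perp A' : Subgroup K) : ℤ)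
        = ∑ c ∈ fsub C, if c ∈ h.perp A' then (1 : ℤ) else 0 := by
      intro A' _; rw [sum_ite_fsub, mul_one]
    rw [Finset.sum_congr rfl this, Finset.sum_comm]
    apply Finset.sum_congr rfl
    intro c _
    rw [← Finset.sum_filter]; simp
  have e2 : ∑ c ∈ fsub C, ((F.filter (fun A' => c ∈ h.perp A')).card : ℤ)
      ≤ ∑ c ∈ fsub C, ((if c ∈ h.Z then ((t : ℤ) - 1) else 0) + 2) := by
    apply Finset.sum_le_sum
    intro c _
    split_ifs with hcZ
    · have := Finset.card_filter_le F (fun A' => c ∈ h.perp A')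
      rw [h.conf.card_F] at this
      have : ((F.filter (fun A' => c ∈ h.perp A')).card : ℤ) ≤ t + 1 := by exact_mod_cast this
      linarith
    · have := h.card_perp_le hcZ
      rw [zero_add]
      exact_mod_cast this
  rw [Finset.sum_add_distrib, sum_ite_fsub, Finset.sum_const, card_fsub, h.conf.card_C, ← e1] at e2
  have e3 : ∑ A' ∈ F, (t : ℤ) ≤ ∑ A' ∈ F, 2 * (Nat.card (C ⊓ h.perp A' : Subgroup K) : ℤ) := by
    apply Finset.sum_le_sum
    intro A' hA'
    exact_mod_cast hall A' hA'
  rw [Finset.sum_const, h.conf.card_F, ← Finset.mul_sum] at e3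
  simp only [nsmul_eq_mul] at e2 e3
  push_cast at e3
  have hz4 : 4 * Nat.card (C ⊓ h.Z : Subgroup K) ≤ t := by omega
  zify at hz4 hz ht
  nlinarith

/-- Case beta with `ρ ≥ 2`. -/
theorem case_beta2 (h : QF t F C q β) {A₀ : Subgroup K} (hA₀ : A₀ ∈ F)
    (hI₀ : ∀ x ∈ h.perp A₀, q x = 0) (hρ : 2 ≤ Nat.card (A₀ ⊓ h.Z : Subgroup K)) : False := by
  classical
  have ht := h.conf.two_le
  have hZ := h.typeI_card hA₀ hI₀
  have hge : ∀ A ∈ F, Nat.card (A₀ ⊓ h.Z : Subgroup K) ≤ Nat.card (A ⊓ h.Z : Subgroup K) := by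
    intro A hA
    have := h.card_Z_le hA
    rw [hZ] at this
    have := Nat.le_of_mul_le_mul_left this (by omega)
    exact (Nat.pow_le_pow_iff_left (by norm_num)).1 this
  have hI : ∀ A ∈ F, ∀ x ∈ h.perp A, q x = 0 := by
    intro A hA y hy
    by_contra hq
    have hd := h.dichotomy hA hy hq
    have hγ : Nat.card (C ⊓ h.perp A : Subgroup K) ≤ t := by
      have h8 : Nat.card (C ⊓ h.perp A : Subgroup K) ≤ Nat.card C := Subgroup.card_le_of_le inf_le_left
      rwa [h.conf.card_C] at h8
    have hg := hge A hA
    have h2 : Nat.card (A ⊓ h.Z : Subgroup K) ≤ 2 := by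
      apply Nat.le_of_mul_le_mul_left _ (show 0 < t by omega)
      linarith
    have h3 : Nat.card (A ⊓ h.Z : Subgroup K) = 2 := by omega
    have h4 : Nat.card (A₀ ⊓ h.Z : Subgroup K) = 2 := by omega
    have h5 := h.card_perp_perp hA
    have h6 := h.card_perp hA
    rw [h3] at h5 h6
    rw [hZ, h4] at h5
    have h7 : h.perp (h.perp A) = h.perp A := Subgroup.eq_of_le_of_card_ge (h.perp_perp_le hA)
      (by rw [h6]; nlinarith)
    have hyH : y ∈ A ⊔ C := by
      by_contra hcon; exact hq (h.q_perp hA hy hcon)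
    have hx : ∃ x ∈ h.perp A, x ∉ A ⊔ C := by
      by_contra hcon
      push Not at hcon
      have : h.perp A ≤ (A ⊔ C) := hcon
      have := Subgroup.card_le_of_le this
      rw [h6, h.conf.card_H A hA] at this
      nlinarith
    obtain ⟨x, hx, hxH⟩ := hx
    apply hq
    rw [h.q_eq_beta hA hx hxH hy hyH]
    rw [← h7] at hx
    exact hx y hy
  have hρA : ∀ A ∈ F, Nat.card (A ⊓ h.Z : Subgroup K) = Nat.card (A₀ ⊓ h.Z : Subgroup K) := by
    intro A hA
    have h1 := h.typeI_card hA (hI A hA)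
    rw [hZ] at h1
    have := Nat.eq_of_mul_eq_mul_left (by omega) h1
    exact (Nat.pow_left_injective (n := 2) (by norm_num) this).symm
  have hlt := h.rho_lt hA₀ hI₀
  have hG := h.gauss hA₀ hI₀
  have e1 : ∑ A ∈ F, (Nat.card (h.perp A) : ℤ)
      = ∑ x, ((F.filter (fun A => x ∈ h.perp A)).card : ℤ) := by
    have : ∀ A ∈ F, (Nat.card (h.perp A) : ℤ) = ∑ x, if x ∈ h.perp A then (1 : ℤ) else 0 := by
      intro A _
      have := sum_ite_fsub ⊤ (h.perp A) 1
      rw [fsub_top, top_inf_eq, mul_one] at this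
      exact this.symm
    rw [Finset.sum_congr rfl this, Finset.sum_comm]
    apply Finset.sum_congr rfl
    intro c _
    rw [← Finset.sum_filter]; simp
  have e2 : ∑ x, ((F.filter (fun A => x ∈ h.perp A)).card : ℤ)
      ≤ ∑ x, ((if x ∈ h.Z then ((t : ℤ) - 1) else 0) + (1 + sg (q x))) := by
    apply Finset.sum_le_sum
    intro x _
    by_cases hqx : q x = 0
    · rw [hqx, sg_zero]
      split_ifs with hcZ
      · have := Finset.card_filter_le F (fun A' => x ∈ h.perp A')
        rw [h.conf.card_F] at this
        have : ((F.filter (fun A' => x ∈ h.perp A')).card : ℤ) ≤ t + 1 := by exact_mod_cast this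
        linarith
      · have := h.card_perp_le hcZ
        rw [zero_add]
        exact_mod_cast this
    · have h1 : x ∉ h.Z := fun hx => hqx (hI₀ x (h.Z_le_perp _ hx))
      have h2 : F.filter (fun A => x ∈ h.perp A) = ∅ := by
        rw [Finset.filter_eq_empty_iff]
        intro A hA hx
        exact hqx (hI A hA x hx)
      rw [h2, if_neg h1, sg_of_ne hqx]; simp
  have e3 := sum_ite_fsub ⊤ h.Z ((t : ℤ) - 1)
  rw [fsub_top, top_inf_eq] at e3
  have e4 : ∑ A ∈ F, (Nat.card (h.perp A) : ℤ)
      = (t + 1) * (t ^ 2 * Nat.card (A₀ ⊓ h.Z : Subgroup K)) := by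
    have : ∀ A ∈ F, (Nat.card (h.perp A) : ℤ) = t ^ 2 * Nat.card (A₀ ⊓ h.Z : Subgroup K) := by
      intro A hA
      rw [h.card_perp hA, hρA A hA]; push_cast; rfl
    rw [Finset.sum_congr rfl this, Finset.sum_const, h.conf.card_F]; simp
  rw [Finset.sum_add_distrib, e3, Finset.sum_add_distrib, hG, Finset.sum_const, Finset.card_univ,
    ← Nat.card_eq_fintype_card, h.conf.card_K, h.card_perp hA₀, hZ, ← e1, e4] at e2
  generalize Nat.card (A₀ ⊓ h.Z : Subgroup K) = r at *
  simp only [nsmul_eq_mul] at e2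
  push_cast at e2
  zify at ht hρ hlt
  have ht' : (0 : ℤ) < t := by linarith
  have e5 : (t : ℤ) * (((t : ℤ) - r) * (r * t - t - r)) ≤ 0 := by nlinarith
  have e6 : (0 : ℤ) < (t : ℤ) - r := by linarith
  have e7 : (0 : ℤ) < (r : ℤ) * t - t - r := by nlinarith
  have := mul_pos ht' (mul_pos e6 e7)
  linarith

/-- The noncentral case is impossible. -/
theorem noncentral (h : QF t F C q β) (hC : ¬ C ≤ h.Z) : False := by
  classical
  have ht := h.conf.two_le
  have hz := h.z_ge
  obtain ⟨c₀, hc₀, hc₀Z⟩ := Set.not_subset.1 hC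
  let E := F.filter (fun A => C ≤ h.perp A)
  have hE : E.card ≤ 2 := by
    refine le_trans (Finset.card_le_card ?_) (h.card_perp_le hc₀Z)
    intro A hA
    rw [Finset.mem_filter] at hA ⊢
    exact ⟨hA.1, hA.2 hc₀⟩
  have hI : ∀ A ∈ F, ¬ C ≤ h.perp A → ∀ x ∈ h.perp A, q x = 0 := by
    intro A hA hgen y hy
    by_contra hq
    exact h.case_alpha hA hgen hy hq
  have h2z := two_mul_card_le (X := C ⊓ h.Z) (Y := C) inf_le_left hc₀ (fun hh => hc₀Z hh.2)
  rw [h.conf.card_C] at h2z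
  obtain ⟨A₀, hA₀, hA₀E⟩ : ∃ A ∈ F, A ∉ E :=
    Finset.exists_mem_notMem_of_card_lt_card (by rw [h.conf.card_F]; omega)
  have hgen₀ : ¬ C ≤ h.perp A₀ := fun hh => hA₀E (Finset.mem_filter.2 ⟨hA₀, hh⟩)
  have hI₀ := hI A₀ hA₀ hgen₀
  by_cases hρ : 2 ≤ Nat.card (A₀ ⊓ h.Z : Subgroup K)
  · exact h.case_beta2 hA₀ hI₀ hρ
  have hρ1 : Nat.card (A₀ ⊓ h.Z : Subgroup K) = 1 := by have := h.rho_pos A₀; omega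
  have hG := h.gauss hA₀ hI₀
  rw [h.card_perp hA₀, hρ1, h.conf.sum_K] at hG
  have hHA : ∀ A ∈ F, ∑ x ∈ fsub (A ⊔ C), sg (q x)
      = t * ∑ c ∈ fsub C, if c ∈ h.perp A then sg (q c) else 0 := by
    intro A hA
    rw [h.conf.sum_H hA, Finset.sum_comm, Finset.mul_sum]
    apply Finset.sum_congr rfl
    intro c _
    have : ∀ a ∈ fsub A, sg (q (a * c)) = sg (q c) * sg (β c a) := by
      intro a ha
      rw [h.q_mul, h.q_A A hA a (mem_fsub.1 ha), zero_add, sg_add, h.symm]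
    rw [Finset.sum_congr rfl this, ← Finset.mul_sum, h.sum_beta, h.conf.card_A A hA]
    split_ifs <;> ring
  rw [Finset.sum_congr rfl hHA, ← Finset.mul_sum] at hG
  set g := ∑ c ∈ fsub C, sg (q c) with hg
  have hgA1 : ∀ A ∈ E, (∑ c ∈ fsub C, if c ∈ h.perp A then sg (q c) else 0) = g := by
    intro A hA
    rw [Finset.mem_filter] at hA
    apply Finset.sum_congr rfl
    intro c hc
    rw [if_pos (hA.2 (mem_fsub.1 hc))]
  have hgA2 : ∀ A ∈ F \ E, (2 : ℤ) ≤ (∑ c ∈ fsub C, if c ∈ h.perp A then sg (q c) else 0) := by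
    intro A hA
    rw [Finset.mem_sdiff] at hA
    have hA' : ¬ C ≤ h.perp A := fun hh => hA.2 (Finset.mem_filter.2 ⟨hA.1, hh⟩)
    have : (∑ c ∈ fsub C, if c ∈ h.perp A then sg (q c) else 0)
        = Nat.card (C ⊓ h.perp A : Subgroup K) * 1 := by
      rw [← sum_ite_fsub]
      apply Finset.sum_congr rfl
      intro c _
      split_ifs with hc
      · rw [hI A hA.1 hA' c hc, sg_zero]
      · rfl
    rw [this]
    have : Nat.card (C ⊓ h.Z : Subgroup K) ≤ Nat.card (C ⊓ h.perp A : Subgroup K) :=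
      Subgroup.card_le_of_le (inf_le_inf_left _ (h.Z_le_perp A))
    have : 2 ≤ Nat.card (C ⊓ h.perp A : Subgroup K) := by omega
    rw [mul_one]
    exact_mod_cast this
  have hEF : E ⊆ F := Finset.filter_subset _ _
  have hsum := Finset.sum_sdiff
    (f := fun A => ∑ c ∈ fsub C, if c ∈ h.perp A then sg (q c) else 0) hEF
  rw [Finset.sum_congr rfl hgA1, Finset.sum_const] at hsum
  have hlow := Finset.sum_le_sum hgA2
  rw [Finset.sum_const, Finset.card_sdiff_of_subset hEF, h.conf.card_F] at hlow
  rw [← hsum] at hG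
  have hgle : g ≤ t := by
    rw [hg, ← h.conf.card_C, ← card_fsub]
    calc _ ≤ ∑ c ∈ fsub C, (1 : ℤ) := Finset.sum_le_sum (fun c _ => sg_le _)
      _ = _ := by simp
  have hgge : 2 * (Nat.card (C ⊓ h.Z : Subgroup K) : ℤ) - t ≤ g := by
    have : ∑ c ∈ fsub C, ((if c ∈ h.Z then (2 : ℤ) else 0) - 1) ≤ g := by
      apply Finset.sum_le_sum
      intro c _
      split_ifs with hc
      · rw [hI₀ c (h.Z_le_perp _ hc), sg_zero]; norm_num
      · have := sg_ge (q c); linarith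
    rw [Finset.sum_sub_distrib, sum_ite_fsub, Finset.sum_const, card_fsub, h.conf.card_C] at this
    simp only [nsmul_eq_mul, mul_one] at this
    linarith
  set S := ∑ A ∈ F \ E, ∑ c ∈ fsub C, if c ∈ h.perp A then sg (q c) else 0
  have ht0 : (t : ℤ) ≠ 0 := by have : t ≠ 0 := by omega
                               exact_mod_cast this
  have hmain : S + E.card • g - g = t := by
    apply mul_left_cancel₀ ht0
    push_cast at hG
    linarith
  simp only [nsmul_eq_mul] at hmain hlow
  have hc : ((t + 1 - E.card : ℕ) : ℤ) = t + 1 - E.card := by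
    rw [Nat.cast_sub (by omega)]; push_cast; rfl
  rw [hc] at hlow
  zify at hz
  have : E.card = 0 ∨ E.card = 1 ∨ E.card = 2 := by omega
  rcases this with h0 | h0 | h0 <;> rw [h0] at hmain hlow <;> push_cast at hmain hlow <;> omega

end QF

/-- Trace of a matrix `D` with `D² = s D` is `s` times a natural number. -/
theorem trace_of_sq {n : Type*} [Fintype n] [DecidableEq n] (D : Matrix n n ℂ) (s : ℂ) (hs : s ≠ 0)
    (hD : D * D = s • D) : ∃ r : ℕ, D.trace = s * r := by
  have hidem : IsIdempotentElem (Matrix.toLin' (s⁻¹ • D)) := by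
    unfold IsIdempotentElem
    rw [Module.End.mul_eq_comp, ← Matrix.toLin'_mul, Matrix.smul_mul, Matrix.mul_smul, hD,
      smul_smul s⁻¹ s, inv_mul_cancel₀ hs, one_smul]
  refine ⟨Module.finrank ℂ (LinearMap.range (Matrix.toLin' (s⁻¹ • D))), ?_⟩
  have h1 := (LinearMap.IsIdempotentElem.isProj_range _ hidem).trace
  rw [Matrix.trace_toLin'_eq, Matrix.trace_smul] at h1
  rw [← h1, smul_eq_mul, mul_inv_cancel_left₀ hs]

namespace QF
variable {K : Type*} [Group K] [Fintype K] {t : ℕ} {F : Finset (Subgroup K)} {C : Subgroup K}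
  {q : K → ZMod 2} {β : K → K → ZMod 2}

theorem central_exists (h : QF t F C q β) (hC : C ≤ h.Z) : ∃ c ∈ C, q c ≠ 0 := by
  by_contra hcon
  push Not at hcon
  have hall : ∀ x, q x = 0 := by
    intro x
    obtain ⟨A, hA, hx⟩ := h.conf.cover x
    obtain ⟨a, ha, c, hc, rfl⟩ := (h.conf.mem_H A hA x).1 hx
    rw [h.q_mul, h.q_A A hA a ha, hcon c hc, h.symm, h.mem_Z.1 (hC hc)]; simp
  obtain ⟨x, y, hxy⟩ := h.ne
  exact hxy (h.isotropic (X := ⊤) (fun x _ => hall x) trivial trivial)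

theorem central_perp (h : QF t F C q β) (hC : C ≤ h.Z) {A : Subgroup K} (hA : A ∈ F) {x : K}
    (hx : x ∈ h.perp A) : x ∈ A ⊔ C := by
  by_contra hxH
  obtain ⟨c, hc, hqc⟩ := h.central_exists hC
  have h1 := h.q_perp hA ((h.perp A).mul_mem hx (h.Z_le_perp A (hC hc)))
    (by rwa [Subgroup.mul_mem_cancel_right _ (Subgroup.mem_sup_right hc)])
  rw [h.q_mul, h.q_perp hA hx hxH, h.symm, h.mem_Z.1 (hC hc)] at h1
  apply hqc
  simpa using h1

open Classical in
/-- Extension by zero of the character `L` of `C` (trivially extended to `A`). -/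
noncomputable def phi (A C : Subgroup K) (L : K → ℂ) (x : K) : ℂ :=
  if hx : ∃ c ∈ C, ∃ a ∈ A, x = a * c then L hx.choose else 0

theorem phi_mul (h : QF t F C q β) {A : Subgroup K} (hA : A ∈ F) (L : K → ℂ) {a c : K}
    (ha : a ∈ A) (hc : c ∈ C) : phi A C L (a * c) = L c := by
  have hx : ∃ c' ∈ C, ∃ a' ∈ A, a * c = a' * c' := ⟨c, hc, a, ha, rfl⟩
  rw [phi, dif_pos hx]
  obtain ⟨hc', a', ha', e⟩ := hx.choose_spec
  set c' := hx.choose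
  have h1 : a'⁻¹ * a = c' * c⁻¹ := by
    rw [eq_mul_inv_iff_mul_eq, mul_assoc, e]; group
  have h2 := h.conf.A_inter_C hA (A.mul_mem (A.inv_mem ha') ha)
    (h1 ▸ C.mul_mem hc' (C.inv_mem hc))
  rw [h2] at h1
  rw [eq_mul_inv_iff_mul_eq, one_mul] at h1
  rw [h1]

theorem phi_out (h : QF t F C q β) {A : Subgroup K} (hA : A ∈ F) (L : K → ℂ) {x : K}
    (hx : x ∉ A ⊔ C) : phi A C L x = 0 := by
  rw [phi, dif_neg]
  rintro ⟨c, hc, a, ha, rfl⟩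
  exact hx ((h.conf.mem_H A hA _).2 ⟨a, ha, c, hc, rfl⟩)

theorem phi_right (h : QF t F C q β) {A : Subgroup K} (hA : A ∈ F) (L : K → ℂ)
    (hL : ∀ c ∈ C, ∀ d ∈ C, L (c * d) = L c * L d) (x : K) {c : K} (hc : c ∈ C) :
    phi A C L (x * c) = phi A C L x * L c := by
  by_cases hx : x ∈ A ⊔ C
  · obtain ⟨a, ha, d, hd, rfl⟩ := (h.conf.mem_H A hA x).1 hx
    rw [mul_assoc, h.phi_mul hA L ha (C.mul_mem hd hc), h.phi_mul hA L ha hd, hL d hd c hc]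
  · rw [h.phi_out hA L hx, h.phi_out hA L, zero_mul]
    rwa [Subgroup.mul_mem_cancel_right _ (Subgroup.mem_sup_right hc)]

theorem phi_left (h : QF t F C q β) {A : Subgroup K} (hA : A ∈ F) (L : K → ℂ)
    (hL : ∀ c ∈ C, ∀ d ∈ C, L (c * d) = L c * L d)
    (hLc : ∀ c ∈ C, ∀ g, L (g * c * g⁻¹) = L c) (x : K) {y : K} (hy : y ∈ A ⊔ C) :
    phi A C L (y * x) = phi A C L y * phi A C L x := by
  by_cases hx : x ∈ A ⊔ C
  · obtain ⟨a, ha, d, hd, rfl⟩ := (h.conf.mem_H A hA x).1 hx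
    obtain ⟨b, hb, c, hc, rfl⟩ := (h.conf.mem_H A hA y).1 hy
    have hcc : a⁻¹ * c * a⁻¹⁻¹ ∈ C := h.conf.normal.conj_mem c hc a⁻¹
    have e : b * c * (a * d) = (b * a) * ((a⁻¹ * c * a⁻¹⁻¹) * d) := by group
    rw [e, h.phi_mul hA L (A.mul_mem hb ha) (C.mul_mem hcc hd), h.phi_mul hA L ha hd,
      h.phi_mul hA L hb hc, hL _ hcc _ hd, hLc c hc]
  · rw [h.phi_out hA L hx, h.phi_out hA L, mul_zero]
    rwa [Subgroup.mul_mem_cancel_left _ hy]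

theorem phi_conv (h : QF t F C q β) {A B : Subgroup K} (hA : A ∈ F) (hB : B ∈ F) (hne : B ≠ A)
    [Fintype B] (L : K → ℂ)
    (hL : ∀ c ∈ C, ∀ d ∈ C, L (c * d) = L c * L d)
    (hLc : ∀ c ∈ C, ∀ g, L (g * c * g⁻¹) = L c) (x y : K) :
    ∑ b : B, phi A C L (x * b) * phi A C L ((b : K)⁻¹ * y) = phi A C L (x * y) := by
  obtain ⟨b, hb, z, hz, e⟩ := h.conf.factor hB hA hne x⁻¹
  have hxb : x * b ∈ A ⊔ C := by
    have : x * b = z⁻¹ := by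
      rw [← inv_inv x, e]; group
    rw [this]; exact (A ⊔ C).inv_mem hz
  rw [Finset.sum_eq_single (⟨b, hb⟩ : B)]
  · simp only
    rw [← h.phi_left hA L hL hLc _ hxb]
    congr 1; group
  · rintro ⟨b', hb'⟩ _ hb'b
    simp only
    rw [h.phi_out hA L, zero_mul]
    intro hxb'
    apply hb'b
    have h1 := (A ⊔ C).mul_mem ((A ⊔ C).inv_mem hxb) hxb'
    rw [show (x * b)⁻¹ * (x * b') = b⁻¹ * b' by group] at h1
    have h2 := h.conf.inter B hB A hA hne _ (B.mul_mem (B.inv_mem hb) hb') h1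
    rw [inv_mul_eq_one] at h2
    exact Subtype.ext h2.symm
  · intro hh; exact absurd (Finset.mem_univ _) hh

/-- The central case is impossible. -/
theorem central (h : QF t F C q β) (hC : C ≤ h.Z) (L : K → ℂ)
    (hL : ∀ c ∈ C, ∀ d ∈ C, L (c * d) = L c * L d)
    (hLc : ∀ c ∈ C, ∀ g, L (g * c * g⁻¹) = L c)
    (hLβ : ∀ x y, L ⁅x, y⁆ = (sg (β x y) : ℂ)) : False := by
  classical
  have ht := h.conf.two_le
  have hL1 : L 1 = 1 := by
    have := hLβ 1 1
    rw [h.self, sg_zero] at this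
    simpa using this
  obtain ⟨c₁, hc₁, hLc₁⟩ : ∃ c ∈ C, L c ≠ 1 := by
    obtain ⟨x, y, hxy⟩ := h.ne
    refine ⟨⁅x, y⁆, h.conf.comm_mem x y, ?_⟩
    rw [hLβ, sg_of_ne hxy]; norm_num
  obtain ⟨A, hA, -⟩ := h.conf.exists_ne ⊥
  obtain ⟨B, hB, hne⟩ := h.conf.exists_ne A
  let D : Matrix B B ℂ := fun b' b => ∑ X ∈ F, ∑ g ∈ fsub X, phi A C L ((b' : K)⁻¹ * g * b)
  have hD : D * D = (2 * t : ℂ) • D := by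
    ext b' b''
    rw [Matrix.mul_apply, Matrix.smul_apply, smul_eq_mul]
    set f : K → ℂ := fun x => phi A C L ((b' : K)⁻¹ * x * b'') with hf
    have hfc : ∀ x, f (x * c₁) = f x * L c₁ := by
      intro x
      simp only [hf]
      have hcc : (b'' : K)⁻¹ * c₁ * (b'' : K)⁻¹⁻¹ ∈ C := h.conf.normal.conj_mem c₁ hc₁ _
      have e : (b' : K)⁻¹ * (x * c₁) * b'' =
        ((b' : K)⁻¹ * x * b'') * ((b'' : K)⁻¹ * c₁ * (b'' : K)⁻¹⁻¹) := by group
      rw [e, h.phi_right hA L hL _ hcc, hLc c₁ hc₁]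
    have hf0 : ∀ X : Subgroup K, C ≤ X → ∑ x ∈ fsub X, f x = 0 := by
      intro X hX
      have h1 := sum_fsub_mul_right X f (hX hc₁)
      simp_rw [hfc] at h1
      rw [← Finset.sum_mul] at h1
      have h2 : (∑ x ∈ fsub X, f x) * (L c₁ - 1) = 0 := by rw [mul_sub, h1]; ring
      rcases mul_eq_zero.1 h2 with h3 | h3
      · exact h3
      · exact absurd (sub_eq_zero.1 h3) hLc₁
    have hsum : ∑ b : B, D b' b * D b b'' =
        ∑ X ∈ F, ∑ a ∈ fsub X, ∑ Y ∈ F, ∑ g ∈ fsub Y, f (a * g) := by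
      have e1 : ∀ b : B, D b' b * D b b'' = ∑ X ∈ F, ∑ a ∈ fsub X, ∑ Y ∈ F, ∑ g ∈ fsub Y,
          phi A C L ((b' : K)⁻¹ * a * b) * phi A C L ((b : K)⁻¹ * (g * b'')) := by
        intro b
        simp only [D]
        rw [Finset.sum_mul]
        refine Finset.sum_congr rfl fun X _ => ?_
        rw [Finset.sum_mul]
        refine Finset.sum_congr rfl fun a _ => ?_
        rw [Finset.mul_sum]
        refine Finset.sum_congr rfl fun Y _ => ?_
        rw [Finset.mul_sum]
        refine Finset.sum_congr rfl fun g _ => ?_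
        simp only [mul_assoc]
      simp_rw [e1]
      rw [Finset.sum_comm]
      refine Finset.sum_congr rfl fun X _ => ?_
      rw [Finset.sum_comm]
      refine Finset.sum_congr rfl fun a _ => ?_
      rw [Finset.sum_comm]
      refine Finset.sum_congr rfl fun Y _ => ?_
      rw [Finset.sum_comm]
      refine Finset.sum_congr rfl fun g _ => ?_
      rw [h.phi_conv hA hB hne L hL hLc]
      simp only [hf, mul_assoc]
    rw [hsum]
    simp only [D]
    rw [Finset.mul_sum]
    refine Finset.sum_congr rfl fun X hX => ?_
    have h1 := h.conf.key_sum hX f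
    have h2 := Finset.sum_sdiff (f := f) (Finset.subset_univ (fsub (X ⊔ C)))
    rw [hf0 _ le_sup_right, add_zero, ← fsub_top, hf0 ⊤ le_top] at h2
    rw [← fsub_top, h2] at h1
    have h3 : ∀ a ∈ fsub X, ∑ Y ∈ F, ∑ g ∈ fsub Y, f (a * g)
        = (∑ x ∈ fsub X, f x) + (t * f a + ∑ Y ∈ F.erase X, ∑ g ∈ (fsub Y).erase 1, f (a * g)) := by
      intro a ha
      rw [← Finset.add_sum_erase F _ hX, sum_fsub_mul_left X f (mem_fsub.1 ha)]
      congr 1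
      have h4 : ∀ Y ∈ F.erase X, ∑ g ∈ fsub Y, f (a * g)
          = f a + ∑ g ∈ (fsub Y).erase 1, f (a * g) := by
        intro Y _
        rw [← Finset.add_sum_erase (fsub Y) _ (mem_fsub.2 Y.one_mem), mul_one]
      rw [Finset.sum_congr rfl h4, Finset.sum_add_distrib, Finset.sum_const,
        Finset.card_erase_of_mem hX, h.conf.card_F]
      simp
    rw [Finset.sum_congr rfl h3, Finset.sum_add_distrib, Finset.sum_add_distrib, h1,
      Finset.sum_const, card_fsub, h.conf.card_A X hX, ← Finset.mul_sum]
    simp only [hf, nsmul_eq_mul]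
    ring
  have htr : D.trace = t * (t + 1) := by
    have e0 : D.trace = ∑ X ∈ F, ∑ g ∈ fsub X, ∑ b : B, phi A C L ((b : K)⁻¹ * g * b) := by
      simp only [Matrix.trace, Matrix.diag, D]
      rw [Finset.sum_comm]
      refine Finset.sum_congr rfl fun X _ => ?_
      rw [Finset.sum_comm]
    have e1 : ∀ X ∈ F, ∑ g ∈ fsub X, ∑ b : B, phi A C L ((b : K)⁻¹ * g * b) = t := by
      intro X hX
      rw [Finset.sum_eq_single (1 : K)]
      · have : ∀ b : B, phi A C L ((b : K)⁻¹ * 1 * b) = 1 := by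
          intro b
          have := h.phi_mul hA L A.one_mem C.one_mem
          rw [hL1] at this
          simpa using this
        simp_rw [this]
        have := h.conf.card_A B hB
        rw [Nat.card_eq_fintype_card] at this
        simp [this]
      · intro g hg hg1
        rw [mem_fsub] at hg
        by_cases hXA : X = A
        · subst hXA
          have e2 : ∀ b : B, phi X C L ((b : K)⁻¹ * g * b) = (sg (β g b) : ℂ) := by
            intro b
            have e3 : (b : K)⁻¹ * g * b = g * ⁅g⁻¹, (b : K)⁻¹⁆ := by
              rw [commutatorElement_def]; group
            rw [e3, h.phi_mul hX L hg (h.conf.comm_mem _ _), hLβ, h.inv_left, h.symm, h.inv_left,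
              h.symm]
          simp_rw [e2]
          have hgp : g ∉ h.perp B := by
            intro hgp
            exact hg1 (h.conf.inter X hX B hB hne.symm g hg (h.central_perp hC hB hgp))
          have e4 := h.sum_beta B g
          rw [if_neg hgp] at e4
          have e5 : ∑ b : B, sg (β g b) = ∑ x ∈ fsub B, sg (β g x) := by
            rw [fsub, Finset.sum_subtype (Finset.univ.filter (fun x => x ∈ B)) (p := fun x => x ∈ B)
              (by simp) (fun x => sg (β g x))]
          rw [← e5] at e4
          exact_mod_cast e4
        · apply Finset.sum_eq_zero
          intro b _
          apply h.phi_out hA L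
          intro hm
          have := h.conf.H_conj hA hm (b : K)⁻¹
          rw [show (b : K)⁻¹⁻¹ * ((b : K)⁻¹ * g * b) * (b : K)⁻¹ = g by group] at this
          exact hg1 (h.conf.inter X hX A hA hXA g hg this)
      · intro hh; exact absurd (mem_fsub.2 X.one_mem) hh
    rw [e0, Finset.sum_congr rfl e1, Finset.sum_const, h.conf.card_F]
    simp; ring
  have ht0 : (t : ℂ) ≠ 0 := by
    have : t ≠ 0 := by omega
    exact_mod_cast this
  obtain ⟨r, hr⟩ := trace_of_sq D (2 * t) (by simpa using ht0) hD
  rw [htr] at hr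
  have h1 : ((t : ℂ) + 1) = 2 * r := by
    apply mul_left_cancel₀ ht0
    rw [hr]; ring
  have h2 : t + 1 = 2 * r := by exact_mod_cast h1
  obtain ⟨s, hs⟩ := h.conf.even
  omega

end QF

namespace ASConf
variable {K : Type*} [Group K] [Fintype K] {t : ℕ} {F : Finset (Subgroup K)} {C : Subgroup K}

theorem sq_commutator (h : ASConf t F C) (x : K) : x ^ 2 ∈ commutator K := by
  rw [← Abelianization.ker_of, MonoidHom.mem_ker, map_pow]
  have hA2 : ∀ A ∈ F, ∀ a ∈ A, (Abelianization.of a) ^ 2 = 1 := by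
    intro A hA a ha
    rw [← map_pow, h.sq_A hA ha, map_one]
  have main : ∀ A ∈ F, ∀ y, y ∉ A ⊔ C → (Abelianization.of y) ^ 2 = 1 := by
    intro A hA y hy
    obtain ⟨a, ha, B, hB, -, hab⟩ := h.key_exists hA hy
    have := hA2 B hB _ hab
    rwa [map_mul, mul_pow, hA2 A hA a ha, one_mul] at this
  obtain ⟨A, hA, hxA⟩ := h.cover x
  obtain ⟨B, hB, hne⟩ := h.exists_ne A
  by_cases hx : x ∈ B ⊔ C
  · have hc := h.H_inter hA hB hne.symm hxA hx
    have : ∃ g ∈ A, g ≠ 1 := by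
      have h1 : (⊥ : Subgroup K) ≠ A := by
        rintro rfl
        have h2 := h.card_A _ hA
        have := h.two_le
        rw [Subgroup.card_bot] at h2
        omega
      obtain ⟨g, hg⟩ := Subgroup.ne_bot_iff_exists_ne_one.1 h1.symm
      exact ⟨g, g.2, fun e => hg (Subtype.ext e)⟩
    obtain ⟨g, hg, hg1⟩ := this
    have hgx : g * x ∉ B ⊔ C := by
      rw [Subgroup.mul_mem_cancel_right _ hx]
      exact fun hh => hg1 (h.inter A hA B hB hne.symm g hg hh)
    have := main B hB _ hgx
    rwa [map_mul, mul_pow, hA2 A hA g hg, one_mul] at this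
  · exact main B hB x hx

theorem exists_N (h : ASConf t F C) (hK : commutator K ≠ ⊥) :
    ∃ N : Subgroup K, N ≤ commutator K ∧ (∀ x ∈ commutator K, ∀ y, ⁅x, y⁆ ∈ N) ∧
      (∀ x ∈ commutator K, ∀ y ∈ commutator K, (x * y ∈ N ↔ (x ∈ N ↔ y ∈ N))) ∧
      ∃ s ∈ commutator K, s ∉ N := by
  have : Fact (Nat.Prime 2) := ⟨Nat.prime_two⟩
  have hnil : Group.IsNilpotent K := h.isPGroup.isNilpotent
  set M := ⁅commutator K, (⊤ : Subgroup K)⁆ with hM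
  have hMK : M ≤ commutator K := Subgroup.commutator_le_left _ _
  have hMne : M ≠ commutator K := by
    intro e
    obtain ⟨n, hn⟩ := Subgroup.nilpotent_iff_lowerCentralSeries.1 hnil
    have : ∀ n, commutator K ≤ (⊤ : Subgroup K).lowerCentralSeries n := by
      intro n
      induction n with
      | zero => exact le_top
      | succ n ih =>
        rw [Subgroup.lowerCentralSeries_succ, ← e, hM]
        exact Subgroup.commutator_mono ih le_rfl
    exact hK (le_bot_iff.1 (hn ▸ this n))
  have hpK : IsPGroup 2 (commutator K) := h.isPGroup.to_subgroup _
  obtain ⟨k, hk⟩ := IsPGroup.iff_card.1 hpK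
  have hpM : IsPGroup 2 (M.subgroupOf (commutator K)) := hpK.to_subgroup _
  obtain ⟨n, hn⟩ := IsPGroup.iff_card.1 hpM
  have hlt : Nat.card (M.subgroupOf (commutator K)) < Nat.card (commutator K) := by
    have h1 := Subgroup.card_le_card_group (M.subgroupOf (commutator K))
    refine lt_of_le_of_ne h1 (fun e => hMne ?_)
    have h2 := Subgroup.eq_top_of_card_eq _ e
    exact le_antisymm hMK (Subgroup.subgroupOf_eq_top.1 h2)
  have hnk : n < k := by
    rw [hn, hk] at hlt
    exact (Nat.pow_lt_pow_iff_right (by norm_num)).1 hlt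
  obtain ⟨N', hN'c, hN'⟩ := Sylow.exists_subgroup_card_pow_prime_le 2 (m := k - 1)
    (by rw [hk]; exact pow_dvd_pow 2 (by omega)) (M.subgroupOf (commutator K)) hn (by omega)
  have hidx : N'.index = 2 := by
    have := N'.card_mul_index
    rw [hN'c, hk] at this
    have h3 : 2 ^ k = 2 ^ (k - 1) * 2 := by rw [← pow_succ]; congr 1; omega
    rw [h3] at this
    exact Nat.eq_of_mul_eq_mul_left (by positivity) this
  have hmem : ∀ x (hx : x ∈ commutator K), x ∈ N'.map (commutator K).subtype ↔ ⟨x, hx⟩ ∈ N' := by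
    intro x hx
    rw [Subgroup.mem_map]
    constructor
    · rintro ⟨y, hy, rfl⟩; exact hy
    · intro hy; exact ⟨⟨x, hx⟩, hy, rfl⟩
  refine ⟨N'.map (commutator K).subtype, Subgroup.map_subtype_le _, ?_, ?_, ?_⟩
  · intro x hx y
    have h4 : ⁅x, y⁆ ∈ M := Subgroup.commutator_mem_commutator hx trivial
    rw [hmem _ (hMK h4)]
    exact hN' (Subgroup.mem_subgroupOf.2 h4)
  · intro x hx y hy
    rw [hmem x hx, hmem y hy, hmem _ ((commutator K).mul_mem hx hy)]
    exact Subgroup.mul_mem_iff_of_index_two hidx (a := ⟨x, hx⟩) (b := ⟨y, hy⟩)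
  · by_contra hcon
    push Not at hcon
    have : N' = ⊤ := by
      rw [eq_top_iff]
      rintro ⟨x, hx⟩ -
      exact (hmem x hx).1 (hcon x hx)
    rw [this, Subgroup.index_top] at hidx
    omega

open Classical in
/-- The indicator functional. -/
noncomputable def fN (N : Subgroup K) (x : K) : ZMod 2 := if x ∈ N then 0 else 1

theorem fN_eq_zero {N : Subgroup K} {x : K} : fN N x = 0 ↔ x ∈ N := by
  unfold fN; split_ifs with hx <;> simp [hx]

theorem commutator_trivial (h : ASConf t F C) : commutator K = ⊥ := by
  classical
  by_contra hK
  obtain ⟨N, hNK, hcomm, hmul, s, hsK, hsN⟩ := h.exists_N hK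
  have hf : ∀ x ∈ commutator K, ∀ y ∈ commutator K, fN N (x * y) = fN N x + fN N y := by
    intro x hx y hy
    have := hmul x hx y hy
    unfold fN
    by_cases h1 : x ∈ N <;> by_cases h2 : y ∈ N <;> simp [this, h1, h2]
    decide
  have hc : ∀ x y : K, ⁅x, y⁆ ∈ commutator K := fun x y => by
    rw [commutator_def]
    exact Subgroup.commutator_mem_commutator trivial trivial
  have hNnorm : N.Normal := by
    constructor
    intro n hn g
    have e : g * n * g⁻¹ = ⁅n, g⁆⁻¹ * n := by rw [commutatorElement_def]; group
    rw [e]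
    exact N.mul_mem (N.inv_mem (hcomm n (hNK hn) g)) hn
  have hfconj : ∀ x ∈ commutator K, ∀ g, fN N (g * x * g⁻¹) = fN N x := by
    intro x hx g
    have e : g * x * g⁻¹ = ⁅x, g⁆⁻¹ * x := by rw [commutatorElement_def]; group
    rw [e, hf _ ((commutator K).inv_mem (hc _ _)) _ hx,
      fN_eq_zero.2 (N.inv_mem (hcomm x hx g)), zero_add]
  have hfinv : ∀ x : K, fN N x⁻¹ = fN N x := by
    intro x; unfold fN; simp
  let q : K → ZMod 2 := fun x => fN N (x ^ 2)
  let β : K → K → ZMod 2 := fun x y => fN N ⁅x, y⁆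
  have hβinv : ∀ x y : K, fN N ⁅x⁻¹, y⁆ = fN N ⁅x, y⁆ := by
    intro x y
    have e : ⁅x⁻¹, y⁆ = x⁻¹ * ⁅x, y⁆⁻¹ * x⁻¹⁻¹ := by simp only [commutatorElement_def]; group
    rw [e, hfconj _ ((commutator K).inv_mem (hc _ _)), hfinv]
  have hQ : QF t F C q β := by
    refine ⟨h, ?_, ?_, ?_, ?_, ?_, ?_, ?_⟩
    · intro x y z
      have e : ⁅x * y, z⁆ = (x * ⁅y, z⁆ * x⁻¹) * ⁅x, z⁆ := by
        simp only [commutatorElement_def]; group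
      simp only [β]
      rw [e, hf _ ((inferInstance : (commutator K).Normal).conj_mem _ (hc y z) x) _ (hc _ _),
        hfconj _ (hc _ _), add_comm]
    · intro x y
      simp only [β]
      rw [← commutatorElement_inv, hfinv]
    · intro x
      simp only [β]
      rw [commutatorElement_self]
      exact fN_eq_zero.2 N.one_mem
    · intro x y
      simp only [q, β]
      have e : (x * y) ^ 2 = x ^ 2 * (⁅x⁻¹, y⁆ * y ^ 2) := by
        simp only [commutatorElement_def, pow_two]; group
      rw [e, hf _ (h.sq_commutator x) _ ((commutator K).mul_mem (hc _ _) (h.sq_commutator y)),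
        hf _ (hc _ _) _ (h.sq_commutator y), hβinv]
      ring
    · intro A hA a ha
      simp only [q]
      rw [h.sq_A hA ha]
      exact fN_eq_zero.2 N.one_mem
    · by_contra hcon
      push Not at hcon
      apply hsN
      have : commutator K ≤ N := by
        rw [commutator_def, Subgroup.commutator_le]
        intro x _ y _
        exact fN_eq_zero.1 (hcon x y)
      exact this hsK
    · refine ⟨s, h.commutator_le hsK, ?_, ?_⟩
      · rintro rfl; exact hsN N.one_mem
      · intro y
        exact fN_eq_zero.2 (hcomm s hsK y)
  by_cases hC : C ≤ hQ.Z
  · have hCN : ∀ c ∈ C, ∀ g, ⁅c, g⁆ ∈ N := fun c hc' g => fN_eq_zero.1 (hQ.mem_Z.1 (hC hc') g)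
    let NC : Subgroup C := N.subgroupOf C
    have hNC : NC.Normal := by simp only [NC]; infer_instance
    letI : CommGroup (C ⧸ NC) :=
      { (inferInstance : Group (C ⧸ NC)) with
        mul_comm := by
          intro a b
          induction a using QuotientGroup.induction_on with | _ a => ?_
          induction b using QuotientGroup.induction_on with | _ b => ?_
          rw [← QuotientGroup.mk_mul, ← QuotientGroup.mk_mul, QuotientGroup.eq]
          rw [Subgroup.mem_subgroupOf]
          have := hCN (b : K)⁻¹ (C.inv_mem b.2) (a : K)⁻¹
          rw [commutatorElement_def] at this
          simpa [mul_assoc] using this }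
    have hs1 : ((⟨s, h.commutator_le hsK⟩ : C) : C ⧸ NC) ≠ 1 := by
      rw [Ne, QuotientGroup.eq_one_iff]
      exact hsN
    obtain ⟨χ, hχ⟩ := CommGroup.exists_apply_ne_one_of_hasEnoughRootsOfUnity (C ⧸ NC) ℂ hs1
    let L : K → ℂ := fun x => if hx : x ∈ C then ((χ ((⟨x, hx⟩ : C) : C ⧸ NC) : ℂˣ) : ℂ) else 0
    have hLd : ∀ x (hx : x ∈ C), L x = ((χ ((⟨x, hx⟩ : C) : C ⧸ NC) : ℂˣ) : ℂ) := by
      intro x hx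
      simp only [L]
      rw [dif_pos hx]
    have hLmul : ∀ c ∈ C, ∀ d ∈ C, L (c * d) = L c * L d := by
      intro c hc' d hd
      rw [hLd c hc', hLd d hd, hLd _ (C.mul_mem hc' hd), ← Units.val_mul, ← map_mul]
      rfl
    have hLN : ∀ n ∈ N, L n = 1 := by
      intro n hn
      have hnC : n ∈ C := h.commutator_le (hNK hn)
      rw [hLd n hnC]
      have : ((⟨n, hnC⟩ : C) : C ⧸ NC) = 1 := by
        rw [QuotientGroup.eq_one_iff]
        exact hn
      rw [this, map_one, Units.val_one]
    have hLs : L s = -1 := by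
      have hsC := h.commutator_le hsK
      have h1 : L s ≠ 1 := by
        rw [hLd s hsC]
        intro e
        exact hχ (Units.val_eq_one.1 e)
      have h2 : L s * L s = 1 := by
        rw [← hLmul s hsC s hsC]
        apply hLN
        rw [hmul s hsK s hsK]
      rcases mul_self_eq_one_iff.1 h2 with h3 | h3
      · exact absurd h3 h1
      · exact h3
    refine hQ.central hC L hLmul ?_ ?_
    · intro c hc' g
      have e : g * c * g⁻¹ = ⁅c, g⁆⁻¹ * c := by rw [commutatorElement_def]; group
      have h1 := N.inv_mem (hCN c hc' g)
      rw [e, hLmul _ (h.commutator_le (hNK h1)) c hc', hLN _ h1, one_mul]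
    · intro x y
      by_cases hxy : ⁅x, y⁆ ∈ N
      · have : β x y = 0 := fN_eq_zero.2 hxy
        rw [hLN _ hxy, this, sg_zero]; simp
      · have h0 : β x y ≠ 0 := fun e => hxy (fN_eq_zero.1 e)
        have h1 : ⁅x, y⁆ * s ∈ N := by
          rw [hmul _ (hc x y) s hsK]
          exact iff_of_false hxy hsN
        have h2 := hLN _ h1
        rw [hLmul _ (h.comm_mem x y) s (h.commutator_le hsK), hLs] at h2
        rw [sg_of_ne h0]
        push_cast
        linear_combination -h2
  · exact hQ.noncentral hC

theorem conclusion (h : ASConf t F C) : (∀ x y : K, x * y = y * x) ∧ (∀ x : K, x ^ 2 = 1) := by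
  have hK := h.commutator_trivial
  constructor
  · intro x y
    have : ⁅x, y⁆ ∈ commutator K := by
      rw [commutator_def]
      exact Subgroup.commutator_mem_commutator trivial trivial
    rw [hK, Subgroup.mem_bot, commutatorElement_eq_one_iff_mul_comm] at this
    exact this
  · intro x
    have := h.sq_commutator x
    rwa [hK, Subgroup.mem_bot] at this

end ASConf

/-- A skew translation generalized quadrangle of even order `(t,t)` is a
translation generalized quadrangle: if `K` has a Kantor family of type `(t,t)`
with `t` even and a normal subgroup `C` of order `t` with `A* = A·C` for all
`A ∈ F`, then `K` is an elementary abelian 2-group. -/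
theorem stgq_even_order_is_tgq
    {K : Type*} [Group K] [Fintype K] {t : ℕ} (ht : Even t)
    (KF : KantorFamily K t t) (C : Subgroup K) (hC : C.Normal)
    (hcard : Nat.card C = t)
    (hstar : ∀ A ∈ KF.F, (KF.star A : Set K) = (A : Set K) * (C : Set K)) :
    (∀ x y : K, x * y = y * x) ∧ (∀ x : K, x ^ 2 = 1) := by
  have hmem : ∀ A ∈ KF.F, ∀ x, x ∈ KF.star A ↔ ∃ a ∈ A, ∃ c ∈ C, x = a * c := by
    intro A hA x
    rw [← SetLike.mem_coe, hstar A hA, Set.mem_mul]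
    constructor
    · rintro ⟨a, ha, c, hc, rfl⟩; exact ⟨a, ha, c, hc, rfl⟩
    · rintro ⟨a, ha, c, hc, rfl⟩; exact ⟨a, ha, c, hc, rfl⟩
  have hsup : ∀ A ∈ KF.F, KF.star A = A ⊔ C := by
    intro A hA
    apply le_antisymm
    · intro x hx
      obtain ⟨a, ha, c, hc, rfl⟩ := (hmem A hA x).1 hx
      exact (A ⊔ C).mul_mem (Subgroup.mem_sup_left ha) (Subgroup.mem_sup_right hc)
    · apply sup_le (KF.le_star A hA)
      intro c hc
      exact (hmem A hA c).2 ⟨1, A.one_mem, c, hc, by simp⟩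
  have conf : ASConf t KF.F C := by
    refine ⟨KF.two_le_u, ht, hC, ?_, KF.card_F, KF.card_mem, hcard, ?_, ?_, ?_, ?_⟩
    · rw [Nat.card_eq_fintype_card, KF.card_K]; ring
    · intro A hA
      rw [← hsup A hA, KF.card_star A hA]; ring
    · intro A hA x
      rw [← hsup A hA, hmem A hA]
    · intro A hA B hB D hD h1 h2 h3 a ha b hb hab
      exact KF.prod_inter A hA B hB D hD h1 h2 h3 _ ⟨a, ha, b, hb, rfl⟩ hab
    · intro A hA B hB hne g hg hgB
      rw [← hsup B hB] at hgB
      exact KF.inter_star A hA B hB hne g hg hgB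
  exact conf.conclusion
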